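/- Let U be a squared four-dimensional Bessel process started at 0 and τ₁^U := inf{ t ≥ 0 : Ū(t) − U(t) ≥ 1 }, where Ū(t) := sup_{s ∈ [0,t]} U(s). Then E[ U(τ₁^U) ] = 2. -/

import Mathlib

open MeasureTheory ProbabilityTheory Real Set Filter

noncomputable section

variable {Ω : Type*} [MeasurableSpace Ω]

/-- A standard one-dimensional Brownian motion (indexed by `ℝ`, with the relevant
properties required for nonnegative times): starts at `0`, has continuous paths,
independent increments, and Gaussian increments of variance `t - s`. -/
structure IsStdBM (P : Measure Ω) (B : ℝ → Ω → ℝ) : Prop where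
  measurable : ∀ t : ℝ, Measurable (B t)
  start : ∀ ω, B 0 ω = 0
  cont : ∀ ω, Continuous fun t => B t ω
  indep : ∀ (n : ℕ) (t : Fin (n + 1) → ℝ), (∀ i, 0 ≤ t i) → Monotone t →
    iIndepFun
      (fun (i : Fin n) ω => B (t i.succ) ω - B (t i.castSucc) ω) P
  gauss : ∀ s t : ℝ, 0 ≤ s → s ≤ t →
    P.map (fun ω => B t ω - B s ω) = gaussianReal 0 (Real.toNNReal (t - s))

/-- A standard `d`-dimensional Brownian motion started at `0`: the coordinate
processes are independent standard one-dimensional Brownian motions. -/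
structure IsStdBMVec (d : ℕ) (P : Measure Ω) (B : ℝ → Ω → EuclideanSpace ℝ (Fin d)) : Prop where
  coord : ∀ i : Fin d, IsStdBM P (fun t ω => B t ω i)
  indepCoord : iIndepFun
    (fun (i : Fin d) ω => fun t : ℝ => B t ω i) P

/-- Last zero of `W` in `[0,1]`. -/
def lastZero (W : ℝ → Ω → ℝ) (ω : Ω) : ℝ := sSup {t ∈ Icc (0:ℝ) 1 | W t ω = 0}

/-- `m` is a standard Brownian meander: obtained from a Brownian motion `W` by
`m s = |W (g + s (1 - g))| / √(1 - g)`, where `g` is the last zero of `W` before time `1`. -/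
def IsBrownianMeander (P : Measure Ω) (m : ℝ → Ω → ℝ) : Prop :=
  ∃ W : ℝ → Ω → ℝ, IsStdBM P W ∧
    ∀ ω, ∀ s ∈ Icc (0:ℝ) 1,
      m s ω = |W (lastZero W ω + s * (1 - lastZero W ω)) ω| / Real.sqrt (1 - lastZero W ω)

/-- Running maximum `X̄(t) = sup_{s ∈ [0,t]} X(s)`. -/
def runMax (X : ℝ → Ω → ℝ) (t : ℝ) (ω : Ω) : ℝ := ⨆ s : Icc (0:ℝ) t, X s ω

/-- Maximal drawdown on `[0,T]` : `sup_{s ∈ [0,T]} (X̄(s) - X(s))`. -/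
def maxDDOn (X : ℝ → Ω → ℝ) (T : ℝ) (ω : Ω) : ℝ := ⨆ s : Icc (0:ℝ) T, (runMax X s ω - X s ω)

/-- Drawdown time `τ_λ^X := inf {t ≥ 0 : X̄(t) - X(t) ≥ λ}`. -/
def ddTime (lam : ℝ) (X : ℝ → Ω → ℝ) (ω : Ω) : ℝ :=
  sInf {t | 0 ≤ t ∧ lam ≤ runMax X t ω - X t ω}

/-- Three-dimensional Bessel process built from a 3-dimensional Brownian motion. -/
def bessel3 (β : ℝ → Ω → EuclideanSpace ℝ (Fin 3)) (t : ℝ) (ω : Ω) : ℝ := ‖β t ω‖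

/-- Squared four-dimensional Bessel process built from a 4-dimensional Brownian motion. -/
def sqBessel4 (γ : ℝ → Ω → EuclideanSpace ℝ (Fin 4)) (t : ℝ) (ω : Ω) : ℝ := ‖γ t ω‖ ^ 2

end

open scoped ENNReal

open scoped NNReal Topology

open scoped NNReal

lemma bm_pre {Ω : Type*} [MeasurableSpace Ω] {P : Measure Ω} {B : ℝ → Ω → ℝ} (h : IsStdBM P B) :
    IsPreBrownianReal (fun (t : ℝ≥0) ω => B t ω) P := by
  refine HasIndepIncrements.isPreBrownianReal_of_hasLaw (fun t => ⟨(h.measurable _).aemeasurable, ?_⟩) ?_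
  · have := h.gauss 0 t le_rfl t.2
    simpa [h.start] using this
  · intro n t ht
    exact h.indep n (fun i => (t i : ℝ)) (fun i => (t i).2) (fun i j hij => by exact_mod_cast ht hij)

lemma indep1 {Ω : Type*} [MeasurableSpace Ω] {P : Measure Ω} {B : ℝ → Ω → ℝ} (h : IsStdBM P B)
    {t d : ℝ} (ht : 0 ≤ t) (hd : 0 ≤ d) :
    IndepFun (fun ω (s : Icc (0:ℝ) t) => B s ω) (fun ω => B (t+d) ω - B t ω) P := by
  have h1 := ((bm_pre h).indepFun_shift ⟨t, ht⟩).symm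
  have m1 : Measurable (fun (x : Set.Iic (⟨t, ht⟩ : ℝ≥0) → ℝ) (s : Icc (0:ℝ) t) =>
      x ⟨⟨s, s.2.1⟩, s.2.2⟩) := by fun_prop
  have m2 : Measurable (fun (y : ℝ≥0 → ℝ) => y ⟨d, hd⟩) := by fun_prop
  have h2 := h1.comp m1 m2
  exact h2

lemma indep4 {Ω : Type*} [MeasurableSpace Ω] {P : Measure Ω}
    {γ : ℝ → Ω → EuclideanSpace ℝ (Fin 4)} (hγ : IsStdBMVec 4 P γ)
    {t d : ℝ} (ht : 0 ≤ t) (hd : 0 ≤ d) :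
    IndepFun (fun ω (i : Fin 4) (s : Icc (0:ℝ) t) => γ s ω i)
      (fun ω (i : Fin 4) => γ (t+d) ω i - γ t ω i) P := by
  have hP := hγ.indepCoord.isProbabilityMeasure
  let 𝓧 : Fin 4 → Bool → Type := fun _ b => Bool.rec ℝ (Icc (0:ℝ) t → ℝ) b
  let m𝓧 : ∀ i j, MeasurableSpace (𝓧 i j) := fun i j => match j with
    | true => (inferInstance : MeasurableSpace (Icc (0:ℝ) t → ℝ))
    | false => (inferInstance : MeasurableSpace ℝ)
  let X : (i : Fin 4) → (j : Bool) → Ω → 𝓧 i j := fun i j ω => match j with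
    | true => fun (s : Icc (0:ℝ) t) => γ s ω i
    | false => γ (t+d) ω i - γ t ω i
  have mX : ∀ i j, @Measurable _ _ _ (m𝓧 i j) (X i j) := by
    intro i j
    have := (hγ.coord i).measurable
    cases j
    · exact (this (t+d)).sub (this t)
    · exact measurable_pi_lambda _ (fun s => this s)
  have h1 : iIndepFun (m := fun i => @MeasurableSpace.pi _ _ (m𝓧 i)) (fun i ω => (X i · ω)) P := by
    let g : ∀ i : Fin 4, (ℝ → ℝ) → ((j : Bool) → 𝓧 i j) := fun i x j => match j with
      | true => fun (s : Icc (0:ℝ) t) => x s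
      | false => x (t+d) - x t
    have hg : ∀ i, @Measurable _ _ _ (@MeasurableSpace.pi _ _ (m𝓧 i)) (g i) := by
      intro i
      refine @measurable_pi_lambda _ _ _ _ (m𝓧 i) _ (fun j => ?_)
      cases j
      · exact (measurable_pi_apply (t+d)).sub (measurable_pi_apply t)
      · exact measurable_pi_lambda _ (fun s => measurable_pi_apply _)
    have := hγ.indepCoord.comp g hg
    convert this using 1
    funext i ω j
    cases j <;> rfl
  have h2 : ∀ i, iIndepFun (m := m𝓧 i) (X i) P := by
    intro i
    have h3 := indep1 (hγ.coord i) ht hd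
    rw [iIndepFun_iff_measure_inter_preimage_eq_mul]
    intro S sets hS
    rw [IndepFun_iff] at h3
    have h4 := h3 (X i true ⁻¹' sets true) (X i false ⁻¹' sets false)
    have hh : ∀ S : Finset Bool, S = ∅ ∨ S = {true} ∨ S = {false} ∨ S = {true, false} := by decide
    rcases hh S with rfl | rfl | rfl | rfl
    · simp
    · simp
    · simp
    · have := h4 ⟨sets true, hS true (by simp), rfl⟩ ⟨sets false, hS false (by simp), rfl⟩
      have e : (⋂ j ∈ ({true, false} : Finset Bool), X i j ⁻¹' sets j) =
          X i true ⁻¹' sets true ∩ X i false ⁻¹' sets false := by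
        ext; simp [and_comm]
      rw [e, this]; simp
  have h5 := iIndepFun_uncurry mX h1 h2
  classical
  let S : Finset ((_ : Fin 4) × Bool) := Finset.univ.filter (fun p => p.2 = true)
  let T : Finset ((_ : Fin 4) × Bool) := Finset.univ.filter (fun p => p.2 = false)
  have hST : Disjoint S T := by
    rw [Finset.disjoint_filter]; intro x _ h; simp [h]
  have h6 := h5.indepFun_finset S T hST (fun p => mX p.1 p.2)
  have m1 : @Measurable _ _ (@MeasurableSpace.pi S (fun a => 𝓧 a.1.1 a.1.2) (fun a => m𝓧 a.1.1 a.1.2)) _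
      (fun x (i : Fin 4) => (x ⟨⟨i, true⟩, by simp [S]⟩ : Icc (0:ℝ) t → ℝ)) :=
    @measurable_pi_lambda _ _ _ (_) _ _ (fun i =>
      @measurable_pi_apply S _ (fun a => m𝓧 a.1.1 a.1.2) (⟨⟨i, true⟩, by simp [S]⟩ : S))
  have m2 : @Measurable _ _ (@MeasurableSpace.pi T (fun a => 𝓧 a.1.1 a.1.2) (fun a => m𝓧 a.1.1 a.1.2)) _
      (fun x (i : Fin 4) => (x ⟨⟨i, false⟩, by simp [T]⟩ : ℝ)) :=
    @measurable_pi_lambda _ _ _ (_) _ _ (fun i =>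
      @measurable_pi_apply T _ (fun a => m𝓧 a.1.1 a.1.2) (⟨⟨i, false⟩, by simp [T]⟩ : T))
  have h7 := h6.comp m1 m2
  exact h7

lemma law4 {Ω : Type*} [MeasurableSpace Ω] {P : Measure Ω}
    {γ : ℝ → Ω → EuclideanSpace ℝ (Fin 4)} (hγ : IsStdBMVec 4 P γ)
    {t d : ℝ} (ht : 0 ≤ t) (hd : 0 ≤ d) :
    P.map (fun ω (i : Fin 4) => γ (t+d) ω i - γ t ω i) =
      Measure.pi (fun _ => gaussianReal 0 d.toNNReal) := by
  have hP := hγ.indepCoord.isProbabilityMeasure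
  have h1 := hγ.indepCoord.comp (fun _ x => x (t+d) - x t) (fun i => by fun_prop)
  have h2 := h1.map_fun_eq_pi_map (fun i =>
    (((hγ.coord i).measurable (t+d)).sub ((hγ.coord i).measurable t)).aemeasurable)
  refine h2.trans ?_
  congr 1
  funext i
  have := (hγ.coord i).gauss t (t+d) ht (by linarith)
  rw [add_sub_cancel_left] at this
  exact this


/-- `hR R x = ∫_0^R e^{-l x} dl`, a bounded regularization of `1/x`. -/
noncomputable def hR (R x : ℝ) : ℝ := ∫ l in (0:ℝ)..R, rexp (-l * x)

lemma hR_continuous (R : ℝ) : Continuous (hR R) := by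
  unfold hR
  exact intervalIntegral.continuous_parametric_intervalIntegral_of_continuous' (by fun_prop) _ _

lemma hR_nonneg {R x : ℝ} (hR0 : 0 ≤ R) : 0 ≤ hR R x :=
  intervalIntegral.integral_nonneg hR0 (fun _ _ => (exp_pos _).le)

lemma hR_sub {R R' x : ℝ} : hR R x - hR R' x = ∫ l in R'..R, rexp (-l * x) := by
  unfold hR
  have hi : ∀ a b : ℝ, IntervalIntegrable (fun l => rexp (-l * x)) volume a b := fun a b =>
    Continuous.intervalIntegrable (by fun_prop) _ _
  rw [intervalIntegral.integral_interval_sub_left (hi _ _) (hi _ _)]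

lemma hR_mono {R R' x : ℝ} (h : R' ≤ R) : hR R' x ≤ hR R x := by
  have : 0 ≤ hR R x - hR R' x := by
    rw [hR_sub]; exact intervalIntegral.integral_nonneg h (fun _ _ => (exp_pos _).le)
  linarith

lemma hR_sub_le {R R' x e : ℝ} (h0 : 0 ≤ R') (h : R' ≤ R) (he : 0 ≤ e) (hx : e ≤ x) :
    hR R x - hR R' x ≤ (R - R') * rexp (-R' * e) := by
  rw [hR_sub]
  have := intervalIntegral.integral_mono_on (f := fun l => rexp (-l * x))
    (g := fun _ => rexp (-R' * e)) (a := R') (b := R) (μ := volume) h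
    (Continuous.intervalIntegrable (by fun_prop) _ _) (by simp) ?_
  · simpa using this
  · intro l hl
    apply exp_le_exp.2
    have h1 := hl.1
    nlinarith [mul_le_mul h1 hx he (h0.trans h1)]

lemma hR_le {R x : ℝ} (h0 : 0 ≤ R) (hx : 0 ≤ x) : hR R x ≤ R := by
  have := hR_sub_le (R := R) (R' := 0) (x := x) (e := 0) le_rfl h0 le_rfl hx
  simpa [hR] using this

lemma hR_zero (R : ℝ) : hR R 0 = R := by simp [hR]

lemma hR_eq {R x : ℝ} (hx : x ≠ 0) : hR R x = (1 - rexp (-R * x)) / x := by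
  unfold hR
  have : ∀ l ∈ uIcc 0 R, HasDerivAt (fun l => - rexp (-l * x) / x) (rexp (-l * x)) l := by
    intro l _
    have h1 : HasDerivAt (fun l => -l * x) (-1 * x) l := ((hasDerivAt_id l).neg).mul_const x
    have := (h1.exp.neg).div_const x
    refine HasDerivAt.congr_deriv (f := fun l => - rexp (-l * x) / x) this ?_
    rw [show -(rexp (-l * x) * (-1 * x)) = rexp (-l * x) * x by ring, mul_div_cancel_right₀ _ hx]
  rw [intervalIntegral.integral_eq_sub_of_hasDerivAt this
    (Continuous.intervalIntegrable (by fun_prop) _ _)]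
  simp
  ring

lemma hR_le_inv {R x : ℝ} (hx : 0 < x) : hR R x ≤ 1 / x := by
  rw [hR_eq hx.ne']
  gcongr
  linarith [exp_pos (-R * x)]

lemma hR_tendsto {x : ℝ} (hx : 0 < x) : Tendsto (fun R : ℝ => hR R x) atTop (𝓝 (1 / x)) := by
  have : (fun R : ℝ => hR R x) = fun R => (1 - rexp (-R * x)) / x := by
    funext R; exact hR_eq hx.ne'
  rw [this]
  have h1 : Tendsto (fun R : ℝ => rexp (-R * x)) atTop (𝓝 0) := by
    apply tendsto_exp_atBot.comp
    exact (tendsto_neg_atTop_atBot).atBot_mul_const hx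
  simpa using (h1.const_sub 1).div_const x

lemma gauss1 (v : ℝ≥0) (hv : v ≠ 0) (l x : ℝ) (hl : 0 ≤ l) :
    ∫ z, rexp (-l * (x + z) ^ 2) ∂(gaussianReal 0 v) =
      (√(1 + 2 * l * v))⁻¹ * rexp (-l * x ^ 2 / (1 + 2 * l * v)) := by
  have hv' : (0:ℝ) < v := by positivity
  rw [integral_gaussianReal_eq_integral_smul hv]
  have hp : 0 < 1 + 2 * l * v := by positivity
  set b : ℝ := (1 + 2 * l * v) / (2 * v) with hb
  have hbp : 0 < b := by positivity
  have : ∀ z : ℝ, gaussianPDFReal 0 v z • rexp (-l * (x + z) ^ 2) =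
      ((√(2 * π * v))⁻¹ * rexp (-l * x ^ 2 / (1 + 2 * l * v))) *
        rexp (-b * (z + 2 * l * v * x / (1 + 2 * l * v)) ^ 2) := by
    intro z
    simp only [gaussianPDFReal_def, smul_eq_mul]
    rw [mul_assoc (√(2 * π * v))⁻¹, ← exp_add, mul_assoc (√(2 * π * v))⁻¹, ← exp_add]
    congr 2
    rw [hb]
    field_simp
    ring
  simp_rw [this]
  rw [integral_const_mul, integral_add_right_eq_self (fun z => rexp (-b * z ^ 2)),
    integral_gaussian, mul_right_comm, ← sqrt_inv, ← sqrt_inv, ← sqrt_mul (by positivity)]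
  congr 2
  rw [hb]
  have := pi_pos
  field_simp

lemma gauss4 (v : ℝ≥0) (hv : v ≠ 0) (l : ℝ) (x : Fin 4 → ℝ) (hl : 0 ≤ l) :
    ∫ z, rexp (-l * ∑ i, (x i + z i) ^ 2) ∂(Measure.pi (fun _ : Fin 4 => gaussianReal 0 v)) =
      rexp (-(l / (1 + 2 * l * v)) * ∑ i, x i ^ 2) * (1 / (1 + 2 * l * v) ^ 2) := by
  have hp : 0 < 1 + 2 * l * v := by positivity
  have : ∀ z : Fin 4 → ℝ, rexp (-l * ∑ i, (x i + z i) ^ 2) = ∏ i, rexp (-l * (x i + z i) ^ 2) := by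
    intro z
    rw [← exp_sum, Finset.mul_sum]
  simp_rw [this]
  rw [integral_fintype_prod_eq_prod (f := fun i z => rexp (-l * (x i + z) ^ 2))]
  simp_rw [gauss1 v hv l _ hl]
  rw [Finset.prod_mul_distrib, ← exp_sum]
  rw [mul_comm]
  congr 1
  · congr 1
    rw [Finset.mul_sum]
    refine Finset.sum_congr rfl (fun i _ => ?_)
    ring
  · simp only [Finset.prod_const, Finset.card_univ, Fintype.card_fin]
    rw [inv_pow, show (4:ℕ) = 2 * 2 from rfl, pow_mul, sq_sqrt hp.le]
    simp

lemma hR_step (v : ℝ≥0) (hv : v ≠ 0) (R : ℝ) (x : Fin 4 → ℝ) (h0 : 0 ≤ R) :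
    ∫ z, hR R (∑ i, (x i + z i) ^ 2) ∂(Measure.pi (fun _ : Fin 4 => gaussianReal 0 v)) =
      hR (R / (1 + 2 * R * v)) (∑ i, x i ^ 2) := by
  unfold hR
  rw [← intervalIntegral_integral_swap]
  · rw [intervalIntegral.integral_congr (g := fun l =>
      ((fun u => rexp (-u * ∑ i, x i ^ 2)) ∘ (fun l => l / (1 + 2 * l * v))) l
        * (1 / (1 + 2 * l * v) ^ 2))]
    · rw [intervalIntegral.integral_comp_mul_deriv (f := fun l : ℝ => l / (1 + 2 * l * v))]
      · simp
      · intro l hl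
        rw [uIcc_of_le h0] at hl
        have hl := hl.1
        have hp : 0 < 1 + 2 * l * v := by positivity
        have h1 : HasDerivAt (fun l : ℝ => 1 + 2 * l * v) (2 * v) l := by
          have := (((hasDerivAt_id l).const_mul 2).mul_const (v:ℝ)).const_add 1
          simpa using this
        refine HasDerivAt.congr_deriv (f := fun l : ℝ => l / (1 + 2 * l * v))
          ((hasDerivAt_id l).div h1 hp.ne') ?_
        congr 1
        simp only [id]
        ring
      · intro l hl
        rw [uIcc_of_le h0] at hl
        have hl := hl.1
        have hp : 0 < 1 + 2 * l * v := by positivity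
        apply ContinuousAt.continuousWithinAt
        have : (1 + 2 * l * v) ^ 2 ≠ 0 := by positivity
        fun_prop (disch := assumption)
      · fun_prop
    · intro l hl
      rw [uIcc_of_le h0] at hl
      simp only [Function.comp]
      rw [gauss4 v hv l x hl.1]
  · have : IsFiniteMeasure ((volume : Measure ℝ).restrict (uIoc 0 R)) := by
      rw [uIoc_of_le h0]; infer_instance
    apply Integrable.of_bound (C := 1)
    · apply Continuous.aestronglyMeasurable
      simp only [Function.uncurry_def]
      fun_prop
    · have : ∀ᵐ p ∂((volume.restrict (uIoc 0 R)).prod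
          (Measure.pi (fun _ : Fin 4 => gaussianReal 0 v))), p.1 ∈ uIoc 0 R := by
        have := (Measure.quasiMeasurePreserving_fst (μ := volume.restrict (uIoc 0 R))
          (ν := Measure.pi (fun _ : Fin 4 => gaussianReal 0 v))).ae
            (ae_restrict_mem measurableSet_uIoc)
        exact this
      filter_upwards [this] with p hp
      rw [uIoc_of_le h0] at hp
      simp only [Function.uncurry_def, norm_eq_abs, abs_exp]
      apply exp_le_one_iff.2
      have : 0 ≤ p.1 * ∑ i, (x i + p.2 i) ^ 2 := mul_nonneg hp.1.le (by positivity)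
      linarith


/-- Running maximum of a path. -/
noncomputable def RM (u : ℝ → ℝ) (t : ℝ) : ℝ := sSup ((fun q => u (q * t)) '' Icc (0:ℝ) 1)

/-- Drawdown of a path. -/
noncomputable def DD (u : ℝ → ℝ) (t : ℝ) : ℝ := RM u t - u t

/-- Drawdown time capped at `T`. -/
noncomputable def sig (T : ℝ) (u : ℝ → ℝ) : ℝ := sInf ({t | 0 ≤ t ∧ 1 ≤ DD u t} ∪ {T})

lemma RM_continuous {u : ℝ → ℝ} (hu : Continuous u) : Continuous (RM u) := by
  unfold RM
  exact isCompact_Icc.continuous_sSup (f := fun t q => u (q * t)) (by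
    simp only [Function.HasUncurry.uncurry, id]; fun_prop)

lemma DD_continuous {u : ℝ → ℝ} (hu : Continuous u) : Continuous (DD u) :=
  (RM_continuous hu).sub hu

lemma image_Icc_mul (u : ℝ → ℝ) {t : ℝ} (ht : 0 ≤ t) :
    (fun q => u (q * t)) '' Icc (0:ℝ) 1 = u '' Icc 0 t := by
  ext y
  constructor
  · rintro ⟨q, hq, rfl⟩
    exact ⟨q * t, ⟨mul_nonneg hq.1 ht, mul_le_of_le_one_left ht hq.2⟩, rfl⟩
  · rintro ⟨s, hs, rfl⟩
    rcases ht.eq_or_lt with rfl | h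
    · exact ⟨0, by simp, by
        have : s = 0 := le_antisymm hs.2 hs.1
        simp [this]⟩
    · exact ⟨s / t, ⟨div_nonneg hs.1 ht, (div_le_one h).2 hs.2⟩, by
        simp only []; rw [div_mul_cancel₀ _ h.ne']⟩

lemma RM_eq (u : ℝ → ℝ) {t : ℝ} (ht : 0 ≤ t) : RM u t = sSup (u '' Icc 0 t) := by
  rw [RM, image_Icc_mul u ht]

lemma runMax_eq_RM {Ω : Type*} (X : ℝ → Ω → ℝ) {t : ℝ} (ht : 0 ≤ t) (ω : Ω) :
    runMax X t ω = RM (fun s => X s ω) t := by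
  rw [RM_eq _ ht, sSup_image']; rfl

lemma le_RM {u : ℝ → ℝ} (hu : Continuous u) {s t : ℝ} (hs : s ∈ Icc 0 t) : u s ≤ RM u t := by
  rw [RM_eq u (hs.1.trans hs.2)]
  exact le_csSup (isCompact_Icc.image hu).bddAbove ⟨s, hs, rfl⟩

lemma exists_RM {u : ℝ → ℝ} (hu : Continuous u) {t : ℝ} (ht : 0 ≤ t) : ∃ s ∈ Icc 0 t, RM u t = u s := by
  obtain ⟨s, hs, h⟩ := (isCompact_Icc.image hu).sSup_mem ((nonempty_Icc.2 ht).image u)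
  exact ⟨s, hs, by rw [RM_eq u ht, h]⟩

lemma le_RM_iff {u : ℝ → ℝ} (hu : Continuous u) {t c : ℝ} (ht : 0 ≤ t) :
    c ≤ RM u t ↔ ∃ s ∈ Icc 0 t, c ≤ u s := by
  constructor
  · intro h
    obtain ⟨s, hs, h'⟩ := exists_RM hu ht
    exact ⟨s, hs, h' ▸ h⟩
  · rintro ⟨s, hs, h⟩
    exact h.trans (le_RM hu hs)

lemma RM_lt_iff {u : ℝ → ℝ} (hu : Continuous u) {t c : ℝ} (ht : 0 ≤ t) :
    RM u t < c ↔ ∀ s ∈ Icc 0 t, u s < c := by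
  rw [← not_le, le_RM_iff hu ht]
  push Not
  rfl

lemma ddTime_eq {Ω : Type*} (X : ℝ → Ω → ℝ) (ω : Ω) :
    ddTime 1 X ω = sInf {t | 0 ≤ t ∧ 1 ≤ DD (fun s => X s ω) t} := by
  unfold ddTime DD
  congr 1
  ext t
  simp only [mem_setOf_eq]
  constructor
  · rintro ⟨h, h'⟩; rw [runMax_eq_RM X h] at h'; exact ⟨h, h'⟩
  · rintro ⟨h, h'⟩; rw [← runMax_eq_RM X h] at h'; exact ⟨h, h'⟩

section det
variable {u : ℝ → ℝ} {T : ℝ}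

lemma DD_zero (u : ℝ → ℝ) : DD u 0 = 0 := by
  simp [DD, RM_eq u le_rfl]

lemma sigset_bdd (hT : 0 ≤ T) : BddBelow ({t | 0 ≤ t ∧ 1 ≤ DD u t} ∪ {T}) := by
  refine ⟨0, ?_⟩
  rintro t (h | h)
  · exact h.1
  · rw [mem_singleton_iff] at h; rw [h]; exact hT

lemma sigset_closed (hu : Continuous u) : IsClosed ({t | 0 ≤ t ∧ 1 ≤ DD u t} ∪ {T}) := by
  refine IsClosed.union ?_ isClosed_singleton
  exact (isClosed_le continuous_const continuous_id).inter
    (isClosed_le continuous_const (DD_continuous hu))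

lemma sig_mem (hu : Continuous u) (hT : 0 ≤ T) : sig T u ∈ ({t | 0 ≤ t ∧ 1 ≤ DD u t} ∪ {T}) :=
  (sigset_closed hu).csInf_mem ⟨T, by simp⟩ (sigset_bdd hT)

lemma sig_le (hT : 0 ≤ T) : sig T u ≤ T := csInf_le (sigset_bdd hT) (by simp)

lemma sig_pos (hu : Continuous u) (hT : 0 < T) : 0 < sig T u := by
  rcases sig_mem hu hT.le with h | h
  · rcases h.1.eq_or_lt with h' | h'
    · have := h.2
      rw [← h', DD_zero] at this
      linarith
    · exact h'
  · rw [mem_singleton_iff] at h; rw [h]; exact hT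

lemma DD_lt_of_lt_sig (hT : 0 ≤ T) {t : ℝ} (ht : 0 ≤ t) (h : t < sig T u) : DD u t < 1 := by
  by_contra! hc
  have : sig T u ≤ t := csInf_le (sigset_bdd hT) (Or.inl ⟨ht, hc⟩)
  linarith

lemma lt_sig_iff (hu : Continuous u) {t : ℝ} (ht : 0 ≤ t) (htT : t < T) :
    t < sig T u ↔ RM (DD u) t < 1 := by
  have hT : 0 ≤ T := by linarith
  rw [RM_lt_iff (DD_continuous hu) ht]
  constructor
  · intro h s hs
    exact DD_lt_of_lt_sig hT hs.1 (lt_of_le_of_lt hs.2 h)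
  · intro h
    by_contra! hc
    rcases sig_mem hu hT with h' | h'
    · have := h _ ⟨h'.1, hc⟩
      linarith [h'.2]
    · rw [mem_singleton_iff] at h'; linarith

lemma DD_sig_le (hu : Continuous u) (hT : 0 < T) : DD u (sig T u) ≤ 1 := by
  have hp := sig_pos hu hT
  have : sig T u ∈ closure (Ioo 0 (sig T u)) := by
    rw [closure_Ioo hp.ne]; exact ⟨hp.le, le_rfl⟩
  have hc : IsClosed {t | DD u t ≤ 1} := isClosed_le (DD_continuous hu) continuous_const
  have hsub : Ioo 0 (sig T u) ⊆ {t | DD u t ≤ 1} := fun t ht =>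
    (DD_lt_of_lt_sig hT.le ht.1.le ht.2).le
  exact closure_minimal hsub hc this

lemma DD_sig_of_lt (hu : Continuous u) (hT : 0 < T) (h : sig T u < T) : DD u (sig T u) = 1 := by
  refine le_antisymm (DD_sig_le hu hT) ?_
  rcases sig_mem hu hT.le with h' | h'
  · exact h'.2
  · rw [mem_singleton_iff] at h'; linarith

lemma sig_eq_dd {t₀ : ℝ} (h0 : 0 ≤ t₀) (h1 : 1 ≤ DD u t₀) (hT : t₀ ≤ T) :
    sig T u = sInf {t | 0 ≤ t ∧ 1 ≤ DD u t} := by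
  have hb : BddBelow {t | 0 ≤ t ∧ 1 ≤ DD u t} := ⟨0, fun t h => h.1⟩
  unfold sig
  rw [csInf_union hb ⟨t₀, h0, h1⟩ (bddBelow_singleton) (singleton_nonempty T), csInf_singleton]
  exact min_eq_left ((csInf_le hb ⟨h0, h1⟩).trans hT)

end det

lemma dense01 {O : Set ℝ} (hO : IsOpen O) {x : ℝ} (hx : x ∈ O) (hx' : x ∈ Icc (0:ℝ) 1) :
    ∃ q : ℚ, (q : ℝ) ∈ O ∧ (q : ℝ) ∈ Icc (0:ℝ) 1 := by
  rw [← closure_Ioo (zero_ne_one)] at hx'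
  obtain ⟨y, hy⟩ := mem_closure_iff.1 hx' O hO hx
  obtain ⟨q, hq⟩ := Rat.denseRange_cast (𝕜 := ℝ).exists_mem_open (hO.inter isOpen_Ioo) ⟨y, hy⟩
  exact ⟨q, hq.1, Ioo_subset_Icc_self hq.2⟩

lemma RM_measurable {Ω : Type*} {m : MeasurableSpace Ω} {X : ℝ → Ω → ℝ}
    (hc : ∀ ω, Continuous fun t => X t ω) (t : ℝ)
    (hm : ∀ q ∈ Icc (0:ℝ) 1, Measurable (X (q * t))) :
    Measurable (fun ω => RM (fun s => X s ω) t) := by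
  refine measurable_of_Ioi (fun c => ?_)
  have : (fun ω => RM (fun s => X s ω) t) ⁻¹' Ioi c =
      ⋃ q : ℚ, ⋃ (_ : (q : ℝ) ∈ Icc (0:ℝ) 1), X (q * t) ⁻¹' Ioi c := by
    ext ω
    simp only [mem_preimage, mem_Ioi, mem_iUnion, exists_prop]
    have hcq : Continuous (fun q => X (q * t) ω) := (hc ω).comp (by fun_prop)
    constructor
    · intro h
      obtain ⟨y, ⟨q, hq, rfl⟩, hy⟩ := exists_lt_of_lt_csSup
        ((nonempty_Icc.2 zero_le_one).image (fun q => X (q * t) ω)) h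
      obtain ⟨q', h1, h2⟩ := dense01 (isOpen_lt continuous_const hcq) hy hq
      exact ⟨q', h2, h1⟩
    · rintro ⟨q, hq, h⟩
      refine lt_of_lt_of_le h ?_
      exact le_csSup (isCompact_Icc.image hcq).bddAbove ⟨q, hq, rfl⟩
  rw [this]
  exact MeasurableSet.iUnion fun q => MeasurableSet.iUnion fun hq => hm q hq measurableSet_Ioi


/-- Discretized stochastic integral along a path. -/
noncomputable def Ssum (g : ℝ → ℝ) (c : ℝ) (T n : ℕ) (u : ℝ → ℝ) : ℝ :=
  ∑ k ∈ Finset.range (T * n), {v : ℝ → ℝ | c ≤ RM v (k / n) ∧ RM (DD v) (k / n) < 1}.indicator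
    (fun v => g (v ((k:ℝ) / n + 1 / n)) - g (v (k / n))) u

lemma Ssum_zero {g u : ℝ → ℝ} {c : ℝ} {T : ℕ} (hu : Continuous u) (hT : 0 < T)
    (hc : ¬ c ≤ RM u (sig T u)) (n : ℕ) : Ssum g c T n u = 0 := by
  refine Finset.sum_eq_zero (fun k hk => ?_)
  refine indicator_of_notMem ?_ _
  rintro ⟨h1, h2⟩
  have hn : 0 < n := Nat.pos_of_ne_zero (by rintro rfl; simp at hk)
  have hn' : (0:ℝ) < n := by exact_mod_cast hn
  have hT' : (0:ℝ) < T := by exact_mod_cast hT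
  have hkT : (k:ℝ) / n < T := by
    rw [div_lt_iff₀ hn']; exact_mod_cast Finset.mem_range.1 hk
  have hk0 : (0:ℝ) ≤ k / n := by positivity
  have := (lt_sig_iff hu hk0 hkT).2 h2
  apply hc
  rw [le_RM_iff hu (sig_pos hu hT').le]
  obtain ⟨s, hs, h⟩ := (le_RM_iff hu hk0).1 h1
  exact ⟨s, ⟨hs.1, hs.2.trans this.le⟩, h⟩

lemma Ssum_eq {u : ℝ → ℝ} {c : ℝ} {T : ℕ} (hu : Continuous u) (hT : 0 < T) (h0 : u 0 < c)
    (hc : c ≤ RM u (sig T u)) : ∃ r : ℝ, 0 ≤ r ∧ u r = c ∧ ∀ (g : ℝ → ℝ) (n : ℕ), 0 < n →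
      Ssum g c T n u = g (u ((⌈sig T u * n⌉₊ : ℝ) / n)) - g (u ((⌈r * n⌉₊ : ℝ) / n)) := by
  have hT' : (0:ℝ) < T := by exact_mod_cast hT
  have hsp := sig_pos hu hT'
  obtain ⟨s, hs, hcs⟩ := (le_RM_iff hu hsp.le).1 hc
  set A : Set ℝ := {s | 0 ≤ s ∧ c ≤ u s} with hA
  have hAc : IsClosed A := (isClosed_le continuous_const continuous_id).inter
    (isClosed_le continuous_const hu)
  have hAb : BddBelow A := ⟨0, fun t h => h.1⟩
  have hr : sInf A ∈ A := hAc.csInf_mem ⟨s, hs.1, hcs⟩ hAb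
  have hrs : sInf A ≤ sig T u := (csInf_le hAb ⟨hs.1, hcs⟩).trans hs.2
  set r := sInf A with hrdef
  have hur : u r = c := by
    refine le_antisymm ?_ hr.2
    by_contra! hlt
    obtain ⟨y, hy, hyc⟩ := intermediate_value_Icc hr.1 hu.continuousOn (show c ∈ Icc (u 0) (u r) from ⟨h0.le, hlt.le⟩)
    have h2 : r ≤ y := csInf_le hAb ⟨hy.1, hyc.ge⟩
    have : y = r := le_antisymm hy.2 h2
    rw [this] at hyc
    linarith
  refine ⟨r, hr.1, hur, fun g n hn => ?_⟩
  have hn' : (0:ℝ) < n := by exact_mod_cast hn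
  have hcond : ∀ k ∈ Finset.range (T * n), (u ∈ {v : ℝ → ℝ | c ≤ RM v ((k:ℝ) / n) ∧ RM (DD v) (k / n) < 1}) ↔
      k ∈ Finset.Ico ⌈r * n⌉₊ ⌈sig T u * n⌉₊ := by
    intro k hk
    have hkT : (k:ℝ) / n < T := by
      rw [div_lt_iff₀ hn']; exact_mod_cast Finset.mem_range.1 hk
    have hk0 : (0:ℝ) ≤ k / n := by positivity
    show _ ∧ _ ↔ _
    rw [← lt_sig_iff hu hk0 hkT, Finset.mem_Ico, Nat.ceil_le, Nat.lt_ceil, le_RM_iff hu hk0,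
      div_lt_iff₀ hn']
    refine and_congr_left (fun _ => ?_)
    rw [← le_div_iff₀ hn']
    constructor
    · rintro ⟨s', hs', h⟩
      exact (csInf_le hAb ⟨hs'.1, h⟩).trans hs'.2
    · intro h
      exact ⟨r, ⟨hr.1, h⟩, hur.ge⟩
  have hb : ⌈sig T u * n⌉₊ ≤ T * n := by
    rw [Nat.ceil_le]; push_cast
    exact mul_le_mul_of_nonneg_right (sig_le hT'.le) hn'.le
  have hab : ⌈r * n⌉₊ ≤ ⌈sig T u * n⌉₊ := Nat.ceil_le_ceil (mul_le_mul_of_nonneg_right hrs hn'.le)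
  set f : ℕ → ℝ := fun k => g (u ((k:ℝ) / n)) with hf
  have e1 : Ssum g c T n u = ∑ k ∈ Finset.Ico ⌈r * n⌉₊ ⌈sig T u * n⌉₊, (f (k+1) - f k) := by
    unfold Ssum
    rw [← Finset.sum_subset (s₁ := Finset.Ico ⌈r * n⌉₊ ⌈sig T u * n⌉₊)]
    · refine Finset.sum_congr rfl (fun k hk => ?_)
      have hk' : k ∈ Finset.range (T * n) := Finset.mem_range.2 ((Finset.mem_Ico.1 hk).2.trans_le hb)
      rw [indicator_of_mem ((hcond k hk').2 hk)]
      simp only [hf]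
      rw [← add_div]; push_cast; rfl
    · intro k hk
      exact Finset.mem_range.2 ((Finset.mem_Ico.1 hk).2.trans_le hb)
    · intro k hk hk'
      exact indicator_of_notMem (fun h => hk' ((hcond k hk).1 h)) _
  rw [e1, Finset.sum_Ico_eq_sub _ hab, Finset.sum_range_sub, Finset.sum_range_sub]
  simp only [hf]
  ring

lemma Ssum_tendsto {g u : ℝ → ℝ} {c : ℝ} {T : ℕ} (hu : Continuous u) (hg : Continuous g)
    (hT : 0 < T) (h0 : u 0 < c) :
    Tendsto (fun n : ℕ => Ssum g c T (n+1) u) atTop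
      (𝓝 ((Ici c).indicator (fun _ => g (u (sig T u)) - g c) (RM u (sig T u)))) := by
  by_cases hc : c ≤ RM u (sig T u)
  · rw [indicator_of_mem (mem_Ici.2 hc)]
    obtain ⟨r, hr0, hur, h⟩ := Ssum_eq hu hT h0 hc
    have hT' : (0:ℝ) < T := by exact_mod_cast hT
    have key : ∀ a : ℝ, 0 ≤ a → Tendsto (fun n : ℕ => g (u ((⌈a * ((n+1 : ℕ) : ℝ)⌉₊ : ℝ) / ((n+1 : ℕ) : ℝ))))
        atTop (𝓝 (g (u a))) := by
      intro a ha
      have h1 := (tendsto_nat_ceil_mul_div_atTop (R := ℝ) ha).comp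
        (tendsto_natCast_atTop_atTop.comp (tendsto_add_atTop_nat 1))
      exact ((hg.comp hu).tendsto a).comp h1
    have := (key _ (sig_pos hu hT').le).sub (key r hr0)
    rw [hur] at this
    refine this.congr (fun n => ?_)
    exact (h g (n+1) (Nat.succ_pos n)).symm
  · have : RM u (sig T u) ∉ Ici c := hc
    rw [indicator_of_notMem this]
    simp_rw [Ssum_zero hu hT hc]
    exact tendsto_const_nhds

lemma Ssum_bound {u : ℝ → ℝ} {c R : ℝ} {T : ℕ} (hu : Continuous u) (hp : ∀ t, 0 ≤ u t) (hR0 : 0 ≤ R)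
    (hT : 0 < T) (h0 : u 0 < c) (n : ℕ) (hn : 0 < n) : |Ssum (hR R) c T n u| ≤ R := by
  by_cases hc : c ≤ RM u (sig T u)
  · obtain ⟨r, hr0, hur, h⟩ := Ssum_eq hu hT h0 hc
    rw [h _ n hn, abs_le]
    have := fun t => hR_nonneg (R := R) (x := u t) hR0
    have h' := fun t => hR_le hR0 (hp t)
    constructor <;> linarith [this (⌈sig T u * n⌉₊ / n), this (⌈r * n⌉₊ / n), h' (⌈sig T u * n⌉₊ / n), h' (⌈r * n⌉₊ / n)]
  · rw [Ssum_zero hu hT hc]; simpa using hR0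


section prob
variable {Ω : Type*} [MeasurableSpace Ω] {P : Measure Ω}
  {γ : ℝ → Ω → EuclideanSpace ℝ (Fin 4)}

/-- The past of the process up to time `t`. -/
def pst (γ : ℝ → Ω → EuclideanSpace ℝ (Fin 4)) (t : ℝ) (ω : Ω) (i : Fin 4) (s : Icc (0:ℝ) t) : ℝ :=
  γ s ω i

lemma sq_eq (t : ℝ) (ω : Ω) : sqBessel4 γ t ω = ∑ i, γ t ω i ^ 2 := by
  rw [sqBessel4, EuclideanSpace.real_norm_sq_eq]

lemma sq_nn (t : ℝ) (ω : Ω) : 0 ≤ sqBessel4 γ t ω := by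
  unfold sqBessel4; positivity

lemma sq_cont (hγ : IsStdBMVec 4 P γ) (ω : Ω) : Continuous (fun t => sqBessel4 γ t ω) := by
  simp_rw [sq_eq]
  exact continuous_finsetSum _ (fun i _ => ((hγ.coord i).cont ω).pow 2)

lemma sq_zero (hγ : IsStdBMVec 4 P γ) (ω : Ω) : sqBessel4 γ 0 ω = 0 := by
  rw [sq_eq]
  simp [fun i => (hγ.coord i).start ω]

lemma sq_meas (hγ : IsStdBMVec 4 P γ) (t : ℝ) : Measurable (sqBessel4 γ t) := by
  have : sqBessel4 γ t = fun ω => ∑ i, γ t ω i ^ 2 := by funext ω; exact sq_eq t ω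
  rw [this]
  exact Finset.measurable_sum _ (fun i _ => ((hγ.coord i).measurable t).pow_const 2)

lemma pst_meas (hγ : IsStdBMVec 4 P γ) (t : ℝ) : Measurable (pst γ t) :=
  measurable_pi_lambda _ (fun i => measurable_pi_lambda _ (fun s => (hγ.coord i).measurable s))

lemma sq_meas_pst {t s : ℝ} (hs : s ∈ Icc 0 t) :
    Measurable[MeasurableSpace.comap (pst γ t) inferInstance] (sqBessel4 γ s) := by
  have : sqBessel4 γ s = (fun y : Fin 4 → Icc (0:ℝ) t → ℝ => ∑ i, y i ⟨s, hs⟩ ^ 2) ∘ pst γ t := by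
    funext ω; exact sq_eq s ω
  rw [this]
  have h : Measurable (fun y : Fin 4 → Icc (0:ℝ) t → ℝ => ∑ i, y i ⟨s, hs⟩ ^ 2) := by fun_prop
  exact h.comp (comap_measurable _)

/-- The event that level `c` was reached and no drawdown occurred up to time `t`. -/
def evA (γ : ℝ → Ω → EuclideanSpace ℝ (Fin 4)) (c t : ℝ) : Set Ω :=
  {ω | c ≤ RM (fun s => sqBessel4 γ s ω) t ∧ RM (DD (fun s => sqBessel4 γ s ω)) t < 1}

lemma Icc_mul_mem {q t : ℝ} (hq : q ∈ Icc (0:ℝ) 1) (ht : 0 ≤ t) : q * t ∈ Icc 0 t :=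
  ⟨mul_nonneg hq.1 ht, mul_le_of_le_one_left ht hq.2⟩

lemma evA_meas (hγ : IsStdBMVec 4 P γ) (c : ℝ) {t : ℝ} (ht : 0 ≤ t) :
    MeasurableSet[MeasurableSpace.comap (pst γ t) inferInstance] (evA γ c t) := by
  have h1 : ∀ s ∈ Icc 0 t, Measurable[MeasurableSpace.comap (pst γ t) inferInstance]
      (fun ω => RM (fun s => sqBessel4 γ s ω) s) := fun s hs =>
    RM_measurable (sq_cont hγ) s (fun q hq => sq_meas_pst
      ⟨(Icc_mul_mem hq hs.1).1, (Icc_mul_mem hq hs.1).2.trans hs.2⟩)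
  have h2 : Measurable[MeasurableSpace.comap (pst γ t) inferInstance]
      (fun ω => RM (DD (fun s => sqBessel4 γ s ω)) t) :=
    RM_measurable (X := fun t ω => DD (fun s => sqBessel4 γ s ω) t)
      (fun ω => DD_continuous (sq_cont hγ ω)) t (fun q hq =>
        (h1 _ (Icc_mul_mem hq ht)).sub (sq_meas_pst (Icc_mul_mem hq ht)))
  exact MeasurableSet.inter (h1 t ⟨ht, le_rfl⟩ measurableSet_Ici) (h2 measurableSet_Iio)

lemma onestep (hγ : IsStdBMVec 4 P γ) {t d R : ℝ} (ht : 0 ≤ t) (hd : 0 < d) (h0 : 0 ≤ R)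
    {E : Set Ω} (hE : MeasurableSet[MeasurableSpace.comap (pst γ t) inferInstance] E) :
    ∫ ω in E, hR R (sqBessel4 γ (t + d) ω) ∂P =
      ∫ ω in E, hR (R / (1 + 2 * R * d)) (sqBessel4 γ t ω) ∂P := by
  have hP := hγ.indepCoord.isProbabilityMeasure
  obtain ⟨A, hA, rfl⟩ := hE
  have hY := pst_meas hγ t
  have hΔ : Measurable (fun ω (i : Fin 4) => γ (t+d) ω i - γ t ω i) :=
    measurable_pi_lambda _ (fun i => ((hγ.coord i).measurable (t+d)).sub ((hγ.coord i).measurable t))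
  have hind := (indepFun_iff_map_prod_eq_prod_map_map hY.aemeasurable hΔ.aemeasurable).1
    (indep4 hγ ht hd.le)
  rw [law4 hγ ht hd.le] at hind
  have tm : t ∈ Icc 0 t := ⟨ht, le_rfl⟩
  let F : (Fin 4 → Icc (0:ℝ) t → ℝ) × (Fin 4 → ℝ) → ℝ := fun p =>
    A.indicator (fun y => hR R (∑ i, (y i ⟨t, tm⟩ + p.2 i) ^ 2)) p.1
  have hFm : Measurable F := by
    have : F = (A ×ˢ univ).indicator (fun p : (Fin 4 → Icc (0:ℝ) t → ℝ) × (Fin 4 → ℝ) => hR R (∑ i, (p.1 i ⟨t, tm⟩ + p.2 i) ^ 2)) := by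
      funext p
      by_cases hp : p.1 ∈ A <;> simp [F, hp, indicator]
    rw [this]
    refine Measurable.indicator ((hR_continuous R).measurable.comp ?_) (hA.prod MeasurableSet.univ)
    fun_prop
  have hd' : d.toNNReal ≠ 0 := by simpa using hd
  have hcoe : ((d.toNNReal : ℝ≥0) : ℝ) = d := Real.coe_toNNReal d hd.le
  have : IsProbabilityMeasure (P.map (pst γ t)) := Measure.isProbabilityMeasure_map hY.aemeasurable
  have hFi : Integrable F ((P.map (pst γ t)).prod (Measure.pi (fun _ => gaussianReal 0 d.toNNReal))) := by
    refine Integrable.of_bound hFm.aestronglyMeasurable R (ae_of_all _ (fun p => ?_))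
    simp only [F]
    by_cases hp : p.1 ∈ A
    · rw [indicator_of_mem hp, norm_eq_abs, abs_of_nonneg (hR_nonneg h0)]
      exact hR_le h0 (by positivity)
    · rw [indicator_of_notMem hp]; simpa using h0
  calc ∫ ω in pst γ t ⁻¹' A, hR R (sqBessel4 γ (t + d) ω) ∂P
      = ∫ ω, F (pst γ t ω, fun i => γ (t+d) ω i - γ t ω i) ∂P := by
        rw [← integral_indicator (hY hA)]
        congr 1
        funext ω
        simp only [F]
        by_cases h : pst γ t ω ∈ A
        · rw [indicator_of_mem (show ω ∈ pst γ t ⁻¹' A from h), indicator_of_mem h, sq_eq]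
          congr 1
          refine Finset.sum_congr rfl (fun i _ => ?_)
          simp [pst]
        · rw [indicator_of_notMem (show ω ∉ pst γ t ⁻¹' A from h), indicator_of_notMem h]
    _ = ∫ p, F p ∂((P.map (pst γ t)).prod (Measure.pi (fun _ => gaussianReal 0 d.toNNReal))) := by
        rw [← hind]
        exact (integral_map (hY.prodMk hΔ).aemeasurable hFm.aestronglyMeasurable).symm
    _ = ∫ y, (∫ z, F (y, z) ∂(Measure.pi (fun _ => gaussianReal 0 d.toNNReal))) ∂(P.map (pst γ t)) :=
        integral_prod _ hFi
    _ = ∫ y, A.indicator (fun y => hR (R / (1 + 2 * R * d)) (∑ i, y i ⟨t, tm⟩ ^ 2)) y ∂(P.map (pst γ t)) := by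
        congr 1
        funext y
        simp only [F]
        by_cases hy : y ∈ A
        · simp only [indicator_of_mem hy]
          have := hR_step d.toNNReal hd' R (fun i => y i ⟨t, tm⟩) h0
          rw [hcoe] at this
          exact this
        · simp [indicator_of_notMem hy]
    _ = ∫ ω, A.indicator (fun y => hR (R / (1 + 2 * R * d)) (∑ i, y i ⟨t, tm⟩ ^ 2)) (pst γ t ω) ∂P := by
        refine integral_map hY.aemeasurable (Measurable.aestronglyMeasurable ?_)
        refine Measurable.indicator ((hR_continuous _).measurable.comp ?_) hA
        fun_prop
    _ = _ := by
        rw [← integral_indicator (hY hA)]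
        congr 1
        funext ω
        by_cases h : pst γ t ω ∈ A
        · rw [indicator_of_mem (show ω ∈ pst γ t ⁻¹' A from h), indicator_of_mem h, sq_eq]
          rfl
        · rw [indicator_of_notMem (show ω ∉ pst γ t ⁻¹' A from h), indicator_of_notMem h]

lemma hR_sq_integrable [IsProbabilityMeasure P] (hγ : IsStdBMVec 4 P γ) {R : ℝ} (h0 : 0 ≤ R) (t : ℝ) :
    Integrable (fun ω => hR R (sqBessel4 γ t ω)) P := by
  refine Integrable.of_bound ((hR_continuous R).measurable.comp (sq_meas hγ t)).aestronglyMeasurable R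
    (ae_of_all _ (fun ω => ?_))
  rw [norm_eq_abs, abs_of_nonneg (hR_nonneg h0)]
  exact hR_le h0 (sq_nn t ω)

lemma evA_measΩ (hγ : IsStdBMVec 4 P γ) (c : ℝ) {t : ℝ} (ht : 0 ≤ t) : MeasurableSet (evA γ c t) :=
  (pst_meas hγ t).comap_le _ (evA_meas hγ c ht)

lemma Ssum_meas (hγ : IsStdBMVec 4 P γ) {R c : ℝ} {T n : ℕ} :
    Measurable (fun ω => Ssum (hR R) c T n (fun s => sqBessel4 γ s ω)) := by
  unfold Ssum
  refine Finset.measurable_sum _ (fun k _ => ?_)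
  have : (fun ω => {v : ℝ → ℝ | c ≤ RM v ((k:ℝ) / n) ∧ RM (DD v) (k / n) < 1}.indicator
    (fun v => hR R (v ((k:ℝ) / n + 1 / n)) - hR R (v (k / n))) (fun s => sqBessel4 γ s ω)) =
    (evA γ c ((k:ℝ) / n)).indicator (fun ω => hR R (sqBessel4 γ ((k:ℝ) / n + 1 / n) ω)
      - hR R (sqBessel4 γ ((k:ℝ) / n) ω)) := by
    funext ω
    by_cases h : ω ∈ evA γ c ((k:ℝ) / n)
    · rw [indicator_of_mem h, indicator_of_mem (show (fun s => sqBessel4 γ s ω) ∈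
        {v : ℝ → ℝ | c ≤ RM v ((k:ℝ) / n) ∧ RM (DD v) (k / n) < 1} from h)]
    · rw [indicator_of_notMem h, indicator_of_notMem (show (fun s => sqBessel4 γ s ω) ∉
        {v : ℝ → ℝ | c ≤ RM v ((k:ℝ) / n) ∧ RM (DD v) (k / n) < 1} from h)]
  rw [this]
  exact (((hR_continuous R).measurable.comp (sq_meas hγ _)).sub
    ((hR_continuous R).measurable.comp (sq_meas hγ _))).indicator (evA_measΩ hγ c (by positivity))

lemma Ssum_integral [IsProbabilityMeasure P] (hγ : IsStdBMVec 4 P γ) {R c : ℝ} (h0 : 0 ≤ R)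
    {T n : ℕ} (hn : 0 < n) :
    ∫ ω, Ssum (hR R) c T n (fun s => sqBessel4 γ s ω) ∂P =
      ∑ k ∈ Finset.range (T * n), ∫ ω in evA γ c ((k:ℝ) / n),
        (hR (R / (1 + 2 * R * (1 / n))) (sqBessel4 γ ((k:ℝ) / n) ω)
          - hR R (sqBessel4 γ ((k:ℝ) / n) ω)) ∂P := by
  have hn' : (0:ℝ) < n := by exact_mod_cast hn
  unfold Ssum
  have e : ∀ k : ℕ, (fun ω => {v : ℝ → ℝ | c ≤ RM v ((k:ℝ) / n) ∧ RM (DD v) (k / n) < 1}.indicator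
    (fun v => hR R (v ((k:ℝ) / n + 1 / n)) - hR R (v (k / n))) (fun s => sqBessel4 γ s ω)) =
    (evA γ c ((k:ℝ) / n)).indicator (fun ω => hR R (sqBessel4 γ ((k:ℝ) / n + 1 / n) ω)
      - hR R (sqBessel4 γ ((k:ℝ) / n) ω)) := by
    intro k
    funext ω
    by_cases h : ω ∈ evA γ c ((k:ℝ) / n)
    · rw [indicator_of_mem h, indicator_of_mem (show (fun s => sqBessel4 γ s ω) ∈
        {v : ℝ → ℝ | c ≤ RM v ((k:ℝ) / n) ∧ RM (DD v) (k / n) < 1} from h)]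
    · rw [indicator_of_notMem h, indicator_of_notMem (show (fun s => sqBessel4 γ s ω) ∉
        {v : ℝ → ℝ | c ≤ RM v ((k:ℝ) / n) ∧ RM (DD v) (k / n) < 1} from h)]
  have hi := fun t => hR_sq_integrable hγ h0 t
  have hi' := fun t => hR_sq_integrable hγ (show 0 ≤ R / (1 + 2 * R * (1 / n)) by positivity) t
  rw [integral_finsetSum]
  · refine Finset.sum_congr rfl (fun k _ => ?_)
    have hk : (0:ℝ) ≤ (k:ℝ) / n := by positivity
    rw [e k, integral_indicator (evA_measΩ hγ c hk), integral_sub (hi _).integrableOn (hi _).integrableOn,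
      integral_sub (hi' _).integrableOn (hi _).integrableOn,
      onestep hγ hk (by positivity) h0 (evA_meas hγ c hk)]
  · intro k _
    rw [e k]
    exact ((hi _).sub (hi _)).indicator (evA_measΩ hγ c (by positivity))

lemma Ssum_integral_nonpos [IsProbabilityMeasure P] (hγ : IsStdBMVec 4 P γ) {R c : ℝ} (h0 : 0 ≤ R)
    {T n : ℕ} (hn : 0 < n) :
    ∫ ω, Ssum (hR R) c T n (fun s => sqBessel4 γ s ω) ∂P ≤ 0 := by
  rw [Ssum_integral hγ h0 hn]
  refine Finset.sum_nonpos (fun k _ => integral_nonpos (fun ω => ?_))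
  have : R / (1 + 2 * R * (1 / n)) ≤ R := div_le_self h0 (by
    have : 0 ≤ 2 * R * (1 / n) := by positivity
    linarith)
  have := hR_mono (x := sqBessel4 γ ((k:ℝ) / n) ω) this
  simpa using this

lemma Ssum_integral_ge [IsProbabilityMeasure P] (hγ : IsStdBMVec 4 P γ) {R c : ℝ} (h0 : 0 ≤ R)
    (hc : 1 ≤ c) {T n : ℕ} (hn : 0 < n) :
    - (2 * T * R ^ 2 * rexp (-(R / (1 + 2 * R * (1 / n))) * (c - 1))) ≤
      ∫ ω, Ssum (hR R) c T n (fun s => sqBessel4 γ s ω) ∂P := by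
  have hn' : (0:ℝ) < n := by exact_mod_cast hn
  rw [Ssum_integral hγ h0 hn]
  set R' := R / (1 + 2 * R * (1 / n)) with hR'
  have hq : 0 ≤ 2 * R * (1 / n) := by positivity
  have hR'0 : 0 ≤ R' := by positivity
  have hR'R : R' ≤ R := div_le_self h0 (by linarith)
  have hdiff : R - R' ≤ 2 * R ^ 2 / n := by
    have : R - R' = R' * (2 * R * (1 / n)) := by
      rw [hR']; field_simp; ring
    rw [this]
    calc R' * (2 * R * (1 / n)) ≤ R * (2 * R * (1 / n)) := by gcongr
      _ = _ := by ring
  set K := 2 * R ^ 2 / n * rexp (-R' * (c - 1)) with hK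
  have hK0 : 0 ≤ K := by positivity
  have : ∀ k ∈ Finset.range (T * n), -K ≤ ∫ ω in evA γ c ((k:ℝ) / n),
        (hR R' (sqBessel4 γ ((k:ℝ) / n) ω) - hR R (sqBessel4 γ ((k:ℝ) / n) ω)) ∂P := by
    intro k _
    have hk : (0:ℝ) ≤ (k:ℝ) / n := by positivity
    have hi := ((hR_sq_integrable hγ hR'0 ((k:ℝ) / n)).sub (hR_sq_integrable hγ h0 ((k:ℝ) / n)))
    have hmono : ∫ ω in evA γ c ((k:ℝ) / n), (-K) ∂P ≤ ∫ ω in evA γ c ((k:ℝ) / n),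
        (hR R' (sqBessel4 γ ((k:ℝ) / n) ω) - hR R (sqBessel4 γ ((k:ℝ) / n) ω)) ∂P := by
      refine setIntegral_mono_on (integrable_const _).integrableOn hi.integrableOn
        (evA_measΩ hγ c hk) (fun ω hω => ?_)
      have hcu := sq_cont hγ ω
      have h1 : c ≤ RM (fun s => sqBessel4 γ s ω) (k / n) := hω.1
      have h2 := (RM_lt_iff (DD_continuous hcu) hk).1 hω.2 _ ⟨hk, le_rfl⟩
      unfold DD at h2
      have h3 : c - 1 ≤ sqBessel4 γ ((k:ℝ) / n) ω := by linarith
      have h4 := hR_sub_le hR'0 hR'R (by linarith) h3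
      have h5 : (R - R') * rexp (-R' * (c - 1)) ≤ K := by rw [hK]; gcongr
      linarith
    refine le_trans ?_ hmono
    rw [setIntegral_const, smul_eq_mul]
    have : P.real (evA γ c ((k:ℝ) / n)) ≤ 1 := measureReal_le_one
    nlinarith
  calc _ = ∑ k ∈ Finset.range (T * n), (-K) := by
        rw [Finset.sum_const, Finset.card_range, nsmul_eq_mul, hK]
        push_cast
        field_simp
    _ ≤ _ := Finset.sum_le_sum this

end prob


section prob2
variable {Ω : Type*} [MeasurableSpace Ω] {P : Measure Ω}
  {γ : ℝ → Ω → EuclideanSpace ℝ (Fin 4)}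

/-- Capped drawdown time. -/
noncomputable def Sg (γ : ℝ → Ω → EuclideanSpace ℝ (Fin 4)) (T : ℕ) (ω : Ω) : ℝ :=
  sig T (fun s => sqBessel4 γ s ω)

/-- Value at the capped drawdown time. -/
noncomputable def Us (γ : ℝ → Ω → EuclideanSpace ℝ (Fin 4)) (T : ℕ) (ω : Ω) : ℝ :=
  sqBessel4 γ (Sg γ T ω) ω

/-- Maximum at the capped drawdown time. -/
noncomputable def Ms (γ : ℝ → Ω → EuclideanSpace ℝ (Fin 4)) (T : ℕ) (ω : Ω) : ℝ :=
  RM (fun s => sqBessel4 γ s ω) (Sg γ T ω)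

lemma RMsq_meas (hγ : IsStdBMVec 4 P γ) (t : ℝ) :
    Measurable (fun ω => RM (fun s => sqBessel4 γ s ω) t) :=
  RM_measurable (sq_cont hγ) t (fun _ _ => sq_meas hγ _)

lemma RMDD_meas (hγ : IsStdBMVec 4 P γ) (t : ℝ) :
    Measurable (fun ω => RM (DD (fun s => sqBessel4 γ s ω)) t) :=
  RM_measurable (X := fun t ω => DD (fun s => sqBessel4 γ s ω) t)
      (fun ω => DD_continuous (sq_cont hγ ω)) t (fun _ _ => (RMsq_meas hγ _).sub (sq_meas hγ _))

lemma Sg_pos (hγ : IsStdBMVec 4 P γ) {T : ℕ} (hT : 0 < T) (ω : Ω) : 0 < Sg γ T ω :=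
  sig_pos (sq_cont hγ ω) (by exact_mod_cast hT)

lemma Sg_meas (hγ : IsStdBMVec 4 P γ) {T : ℕ} (hT : 0 < T) : Measurable (Sg γ T) := by
  have hT' : (0:ℝ) < T := by exact_mod_cast hT
  refine measurable_of_Ioi (fun a => ?_)
  by_cases ha : a < 0
  · have : Sg γ T ⁻¹' Ioi a = univ := by
      ext ω
      simp only [mem_preimage, mem_Ioi, mem_univ, iff_true]
      exact ha.trans (Sg_pos hγ hT ω)
    rw [this]; exact MeasurableSet.univ
  · by_cases ha' : a < T
    · have : Sg γ T ⁻¹' Ioi a = (fun ω => RM (DD (fun s => sqBessel4 γ s ω)) a) ⁻¹' Iio 1 := by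
        ext ω
        exact lt_sig_iff (sq_cont hγ ω) (not_lt.1 ha) ha'
      rw [this]
      exact RMDD_meas hγ a measurableSet_Iio
    · have : Sg γ T ⁻¹' Ioi a = ∅ := by
        ext ω
        simp only [mem_preimage, mem_Ioi, mem_empty_iff_false, iff_false, not_lt]
        exact (sig_le hT'.le).trans (not_lt.1 ha')
      rw [this]; exact MeasurableSet.empty

lemma eval_meas {X : ℝ → Ω → ℝ} {S : Ω → ℝ} (hc : ∀ ω, Continuous fun t => X t ω)
    (hm : ∀ t, Measurable (X t)) (hS : Measurable S) : Measurable (fun ω => X (S ω) ω) := by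
  have h : Measurable (Function.uncurry X) := measurable_uncurry_of_continuous_of_measurable hc hm
  have h2 : Measurable (fun ω => (S ω, ω)) := hS.prodMk measurable_id
  exact h.comp h2

lemma Us_meas (hγ : IsStdBMVec 4 P γ) {T : ℕ} (hT : 0 < T) : Measurable (Us γ T) := by
  unfold Us
  exact eval_meas (X := sqBessel4 γ) (sq_cont hγ) (sq_meas hγ) (Sg_meas hγ hT)

lemma Ms_meas (hγ : IsStdBMVec 4 P γ) {T : ℕ} (hT : 0 < T) : Measurable (Ms γ T) := by
  unfold Ms
  exact eval_meas (X := fun (t : ℝ) ω => RM (fun s => sqBessel4 γ s ω) t)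
    (fun ω => RM_continuous (sq_cont hγ ω)) (RMsq_meas hγ) (Sg_meas hγ hT)

lemma Us_nn (T : ℕ) (ω : Ω) : 0 ≤ Us γ T ω := sq_nn _ _

lemma Us_le_Ms (hγ : IsStdBMVec 4 P γ) {T : ℕ} (hT : 0 < T) (ω : Ω) : Us γ T ω ≤ Ms γ T ω :=
  le_RM (sq_cont hγ ω) (s := Sg γ T ω) ⟨(Sg_pos hγ hT ω).le, le_rfl⟩

lemma Ms_sub_le (hγ : IsStdBMVec 4 P γ) {T : ℕ} (hT : 0 < T) (ω : Ω) : Ms γ T ω - 1 ≤ Us γ T ω := by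
  have := DD_sig_le (sq_cont hγ ω) (T := T) (by exact_mod_cast hT)
  unfold DD at this
  unfold Ms Us Sg
  linarith

/-- The integrand in the level identity. -/
noncomputable def Lint (γ : ℝ → Ω → EuclideanSpace ℝ (Fin 4)) (T : ℕ) (c R : ℝ) (ω : Ω) : ℝ :=
  (Ici c).indicator (fun _ => hR R (Us γ T ω) - hR R c) (Ms γ T ω)

lemma level_tendsto [IsProbabilityMeasure P] (hγ : IsStdBMVec 4 P γ) {T : ℕ} (hT : 0 < T)
    {c R : ℝ} (h0 : 0 ≤ R) (hc : 0 < c) :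
    Tendsto (fun n : ℕ => ∫ ω, Ssum (hR R) c T (n+1) (fun s => sqBessel4 γ s ω) ∂P) atTop
      (𝓝 (∫ ω, Lint γ T c R ω ∂P)) := by
  refine tendsto_integral_of_dominated_convergence (fun _ => R)
    (fun n => (Ssum_meas hγ).aestronglyMeasurable) (integrable_const _) ?_ ?_
  · intro n
    refine ae_of_all _ (fun ω => ?_)
    exact Ssum_bound (sq_cont hγ ω) (fun t => sq_nn t ω) h0 hT (by rw [sq_zero hγ]; exact hc) _
      (Nat.succ_pos n)
  · refine ae_of_all _ (fun ω => ?_)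
    exact Ssum_tendsto (sq_cont hγ ω) (hR_continuous R) hT (by rw [sq_zero hγ]; exact hc)

lemma level_le [IsProbabilityMeasure P] (hγ : IsStdBMVec 4 P γ) {T : ℕ} (hT : 0 < T)
    {c R : ℝ} (h0 : 0 ≤ R) (hc : 0 < c) : ∫ ω, Lint γ T c R ω ∂P ≤ 0 :=
  le_of_tendsto' (level_tendsto hγ hT h0 hc)
    (fun n => Ssum_integral_nonpos hγ h0 (Nat.succ_pos n))

lemma level_ge [IsProbabilityMeasure P] (hγ : IsStdBMVec 4 P γ) {T : ℕ} (hT : 0 < T)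
    {c R : ℝ} (h0 : 0 ≤ R) (hc : 1 ≤ c) :
    - (2 * T * R ^ 2 * rexp (-R * (c - 1))) ≤ ∫ ω, Lint γ T c R ω ∂P := by
  refine le_of_tendsto_of_tendsto' ?_ (level_tendsto hγ hT h0 (by linarith))
    (fun n => Ssum_integral_ge hγ h0 hc (Nat.succ_pos n))
  have h1 : Tendsto (fun n : ℕ => (1:ℝ) / ((n+1 : ℕ) : ℝ)) atTop (𝓝 0) := by
    simpa using tendsto_one_div_add_atTop_nhds_zero_nat (𝕜 := ℝ)
  have h2 : Tendsto (fun n : ℕ => R / (1 + 2 * R * (1 / ((n+1 : ℕ) : ℝ)))) atTop (𝓝 R) := by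
    have := (tendsto_const_nhds (x := R)).div
      ((tendsto_const_nhds (x := (1:ℝ))).add (h1.const_mul (2 * R))) (by norm_num)
    simp only [mul_zero, add_zero, div_one] at this
    exact this
  have h3 := ((continuous_exp.tendsto _).comp (h2.neg.mul_const (c-1))).const_mul (2 * T * R ^ 2)
  exact h3.neg

lemma poly_exp {e : ℝ} (he : 0 < e) (C : ℝ) :
    Tendsto (fun R : ℝ => - (C * R ^ 2 * rexp (-R * e))) atTop (𝓝 0) := by
  have h := (Real.tendsto_pow_mul_exp_neg_atTop_nhds_zero 2).comp (tendsto_id.const_mul_atTop he)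
  have h2 := (h.const_mul (C / e ^ 2)).neg
  simp only [mul_zero, neg_zero] at h2
  refine h2.congr (fun R => ?_)
  simp only [Function.comp, id]
  have : rexp (-(e * R)) = rexp (-R * e) := by ring_nf
  rw [this]
  field_simp

lemma level_real [IsProbabilityMeasure P] (hγ : IsStdBMVec 4 P γ) {T : ℕ} (hT : 0 < T)
    {c : ℝ} (hc : 1 < c) :
    ∫ ω, (Ici c).indicator (fun _ => 1 / Us γ T ω - 1 / c) (Ms γ T ω) ∂P = 0 := by
  have hc0 : 0 < c - 1 := by linarith
  have hlim : Tendsto (fun R : ℝ => ∫ ω, Lint γ T c R ω ∂P) atTop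
      (𝓝 (∫ ω, (Ici c).indicator (fun _ => 1 / Us γ T ω - 1 / c) (Ms γ T ω) ∂P)) := by
    refine tendsto_integral_filter_of_dominated_convergence (fun _ => 1 / (c - 1) + 1 / c) ?_ ?_
      (integrable_const _) ?_
    · refine Eventually.of_forall (fun R => Measurable.aestronglyMeasurable ?_)
      have : Lint γ T c R = (Ms γ T ⁻¹' Ici c).indicator (fun ω => hR R (Us γ T ω) - hR R c) := by
        funext ω; rfl
      rw [this]
      exact (((hR_continuous R).measurable.comp (Us_meas hγ hT)).sub_const _).indicator
        (Ms_meas hγ hT measurableSet_Ici)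
    · filter_upwards [eventually_ge_atTop 0] with R hR0
      refine ae_of_all _ (fun ω => ?_)
      unfold Lint
      by_cases h : Ms γ T ω ∈ Ici c
      · rw [indicator_of_mem h]
        have h' : c ≤ Ms γ T ω := h
        have h1 := Ms_sub_le hγ hT ω
        have h2 : c - 1 ≤ Us γ T ω := by linarith
        have h3 : hR R (Us γ T ω) ≤ 1 / (c - 1) :=
          (hR_le_inv (by linarith)).trans (one_div_le_one_div_of_le hc0 h2)
        have h4 : hR R c ≤ 1 / c := hR_le_inv (by linarith)
        have h5 := hR_nonneg (x := Us γ T ω) hR0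
        have h6 := hR_nonneg (x := c) hR0
        have h7 : 0 ≤ 1 / (c-1) := by positivity
        have h8 : 0 ≤ 1 / c := by positivity
        rw [norm_eq_abs, abs_le]
        constructor <;> linarith
      · rw [indicator_of_notMem h]
        have h7 : 0 ≤ 1 / (c-1) := by positivity
        have h8 : 0 ≤ 1 / c := by positivity
        simp only [norm_zero]; linarith
    · refine ae_of_all _ (fun ω => ?_)
      unfold Lint
      by_cases h : Ms γ T ω ∈ Ici c
      · simp only [indicator_of_mem h]
        have h' : c ≤ Ms γ T ω := h
        have h1 := Ms_sub_le hγ hT ω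
        exact (hR_tendsto (by linarith)).sub (hR_tendsto (by linarith))
      · simp only [indicator_of_notMem h]
        exact tendsto_const_nhds
  refine tendsto_nhds_unique hlim (tendsto_of_tendsto_of_tendsto_of_le_of_le'
    (poly_exp hc0 (2 * T)) tendsto_const_nhds ?_ ?_)
  · filter_upwards [eventually_ge_atTop 0] with R hR0
    exact level_ge hγ hT hR0 hc.le
  · filter_upwards [eventually_ge_atTop 0] with R hR0
    exact level_le hγ hT hR0 (by linarith)

/-- The level identity. -/
def Lv (P : Measure Ω) (M U : Ω → ℝ) : Prop := ∀ c : ℝ, 1 < c →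
  ∫⁻ ω, (Ici c).indicator (fun _ => ENNReal.ofReal (1 / U ω)) (M ω) ∂P =
    ∫⁻ ω, (Ici c).indicator (fun _ => ENNReal.ofReal (1 / c)) (M ω) ∂P

lemma level_Lv [IsProbabilityMeasure P] (hγ : IsStdBMVec 4 P γ) {T : ℕ} (hT : 0 < T) :
    Lv P (Ms γ T) (Us γ T) := by
  intro c hc
  have hc0 : 0 < c - 1 := by linarith
  set A := Ms γ T ⁻¹' Ici c with hAdef
  have hA : MeasurableSet A := Ms_meas hγ hT measurableSet_Ici
  have hU := Us_meas hγ hT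
  have hub : ∀ ω ∈ A, 1 / Us γ T ω ≤ 1 / (c - 1) := fun ω hω => by
    have h1 := Ms_sub_le hγ hT ω
    have h' : c ≤ Ms γ T ω := hω
    exact one_div_le_one_div_of_le hc0 (by linarith)
  have hi : IntegrableOn (fun ω => 1 / Us γ T ω) A P := by
    refine Integrable.of_bound (hU.const_div 1).aestronglyMeasurable (1 / (c-1)) ?_
    filter_upwards [ae_restrict_mem hA] with ω hω
    rw [norm_eq_abs, abs_of_nonneg (one_div_nonneg.2 (Us_nn T ω))]
    exact hub ω hω
  have hi2 : IntegrableOn (fun _ : Ω => 1 / c) A P := (integrable_const _).integrableOn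
  have h1 := level_real hγ hT hc
  have e1 : (fun ω => (Ici c).indicator (fun _ => 1 / Us γ T ω - 1 / c) (Ms γ T ω)) =
    A.indicator (fun ω => 1 / Us γ T ω - 1 / c) := by funext ω; rfl
  rw [e1, integral_indicator hA, integral_sub hi hi2, sub_eq_zero] at h1
  have e2 : (fun ω => (Ici c).indicator (fun _ => ENNReal.ofReal (1 / Us γ T ω)) (Ms γ T ω)) =
    A.indicator (fun ω => ENNReal.ofReal (1 / Us γ T ω)) := by funext ω; rfl
  have e3 : (fun ω => (Ici c).indicator (fun _ => ENNReal.ofReal (1 / c)) (Ms γ T ω)) =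
    A.indicator (fun ω => ENNReal.ofReal (1 / c)) := by funext ω; rfl
  rw [e2, e3, lintegral_indicator hA, lintegral_indicator hA,
    ← ofReal_integral_eq_lintegral_ofReal hi (ae_of_all _ fun ω => one_div_nonneg.2 (Us_nn T ω)),
    ← ofReal_integral_eq_lintegral_ofReal hi2 (ae_of_all _ fun ω => one_div_nonneg.2 (by linarith)), h1]

lemma not_zero [IsProbabilityMeasure P] (hγ : IsStdBMVec 4 P γ) {T : ℕ} (hT : 0 < T) :
    ∀ᵐ ω ∂P, ¬ (Us γ T ω = 0 ∧ 1 / 2 ≤ Ms γ T ω) := by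
  set B : Set Ω := Us γ T ⁻¹' {0} ∩ Ms γ T ⁻¹' Ici (1/2) with hB
  have hBm : MeasurableSet B := (Us_meas hγ hT (measurableSet_singleton 0)).inter
    (Ms_meas hγ hT measurableSet_Ici)
  set A := Ms γ T ⁻¹' Ici (1/2) with hAdef
  have hA : MeasurableSet A := Ms_meas hγ hT measurableSet_Ici
  have key : ∀ R : ℝ, 0 ≤ R → R * P.real B ≤ 2 := by
    intro R hR0
    have h1 := level_le hγ hT hR0 (c := 1/2) (by norm_num)
    have e1 : Lint γ T (1/2) R = A.indicator (fun ω => hR R (Us γ T ω) - hR R (1/2)) := by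
      funext ω; rfl
    have hb := hR_le_inv (R := R) (x := 1/2) (by norm_num)
    have hi : Integrable (fun ω => hR R (Us γ T ω)) P := by
      refine Integrable.of_bound ((hR_continuous R).measurable.comp (Us_meas hγ hT)).aestronglyMeasurable R
        (ae_of_all _ (fun ω => ?_))
      rw [norm_eq_abs, abs_of_nonneg (hR_nonneg hR0)]
      exact hR_le hR0 (Us_nn T ω)
    have hle : ∫ ω, (B.indicator (fun _ => R) ω - 2) ∂P ≤ ∫ ω, Lint γ T (1/2) R ω ∂P := by
      rw [e1]
      refine integral_mono (((integrable_const R).indicator hBm).sub (integrable_const 2))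
        ((hi.sub (integrable_const _)).indicator hA) (fun ω => ?_)
      have h0 := hR_nonneg (x := Us γ T ω) hR0
      by_cases hω : ω ∈ B
      · simp only [indicator_of_mem hω]
        rw [indicator_of_mem hω.2, show Us γ T ω = 0 from hω.1, hR_zero]
        linarith
      · simp only [indicator_of_notMem hω]
        by_cases hω' : ω ∈ A
        · rw [indicator_of_mem hω']; linarith
        · rw [indicator_of_notMem hω']; norm_num
    rw [integral_sub ((integrable_const R).indicator hBm) (integrable_const 2),
      integral_indicator_const _ hBm] at hle
    simp only [smul_eq_mul, integral_const, probReal_univ, one_mul] at hle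
    linarith
  have hz : P.real B = 0 := by
    by_contra hne
    have hpos : 0 < P.real B := lt_of_le_of_ne measureReal_nonneg (Ne.symm hne)
    have := key (3 / P.real B) (by positivity)
    rw [div_mul_cancel₀ _ hne] at this
    norm_num at this
  have hz' : P B = 0 := by simpa [measureReal_eq_zero_iff] using hz
  refine measure_eq_zero_iff_ae_notMem.1 hz' |>.mono (fun ω hω h => hω ⟨h.1, h.2⟩)

end prob2


section absl
variable {Ω : Type*} [MeasurableSpace Ω] {P : Measure Ω} {M U : Ω → ℝ}

lemma lv_tonelli [IsProbabilityMeasure P] (hM : Measurable M) (hU : Measurable U) (h : Lv P M U)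
    {S : Set ℝ} (hS : MeasurableSet S) (hS1 : S ⊆ Ioi 1) :
    ∫⁻ ω, (∫⁻ c in S ∩ Iic (M ω), ENNReal.ofReal (2 * c * (1 / U ω))) ∂P =
      ∫⁻ ω, (∫⁻ c in S ∩ Iic (M ω), 2) ∂P := by
  have hset : MeasurableSet {p : Ω × ℝ | p.2 ≤ M p.1} :=
    measurableSet_le measurable_snd (hM.comp measurable_fst)
  have e : ∀ f : Ω → ℝ → ENNReal, ∀ ω, ∫⁻ c in S ∩ Iic (M ω), f ω c =
      ∫⁻ c in S, {p : Ω × ℝ | p.2 ≤ M p.1}.indicator (fun p => f p.1 p.2) (ω, c) := by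
    intro f ω
    rw [inter_comm, ← Measure.restrict_restrict measurableSet_Iic, ← lintegral_indicator measurableSet_Iic]
    rfl
  rw [lintegral_congr (e (fun ω c => ENNReal.ofReal (2 * c * (1 / U ω)))),
    lintegral_congr (e (fun _ _ => 2))]
  have sw : ∀ g : Ω × ℝ → ENNReal, Measurable g →
      ∫⁻ ω, (∫⁻ c in S, g (ω, c)) ∂P = ∫⁻ c in S, (∫⁻ ω, g (ω, c) ∂P) := fun g hg =>
    lintegral_lintegral_swap (f := fun ω c => g (ω, c)) hg.aemeasurable
  rw [sw _ (Measurable.indicator measurable_const hset), sw _ (Measurable.indicator ?_ hset)]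
  · refine setLIntegral_congr_fun hS (fun c hc => ?_)
    have hc1 : 1 < c := hS1 hc
    have h1 := h c hc1
    have e1 : ∀ ω, {p : Ω × ℝ | p.2 ≤ M p.1}.indicator
        (fun p => ENNReal.ofReal (2 * p.2 * (1 / U p.1))) (ω, c) =
        ENNReal.ofReal (2 * c) * (Ici c).indicator (fun _ => ENNReal.ofReal (1 / U ω)) (M ω) := by
      intro ω
      by_cases hω : c ≤ M ω
      · rw [indicator_of_mem (show (ω, c) ∈ {p : Ω × ℝ | p.2 ≤ M p.1} from hω),
          indicator_of_mem (show M ω ∈ Ici c from hω), ← ENNReal.ofReal_mul (by linarith)]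
      · rw [indicator_of_notMem (show (ω, c) ∉ {p : Ω × ℝ | p.2 ≤ M p.1} from hω),
          indicator_of_notMem (show M ω ∉ Ici c from hω), mul_zero]
    have e2 : ∀ ω, {p : Ω × ℝ | p.2 ≤ M p.1}.indicator
        (fun p => (2 : ENNReal)) (ω, c) =
        ENNReal.ofReal (2 * c) * (Ici c).indicator (fun _ => ENNReal.ofReal (1 / c)) (M ω) := by
      intro ω
      by_cases hω : c ≤ M ω
      · rw [indicator_of_mem (show (ω, c) ∈ {p : Ω × ℝ | p.2 ≤ M p.1} from hω),
          indicator_of_mem (show M ω ∈ Ici c from hω), ← ENNReal.ofReal_mul (by linarith)]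
        have : 2 * c * (1 / c) = 2 := by field_simp
        rw [this]; simp
      · rw [indicator_of_notMem (show (ω, c) ∉ {p : Ω × ℝ | p.2 ≤ M p.1} from hω),
          indicator_of_notMem (show M ω ∉ Ici c from hω), mul_zero]
    rw [lintegral_congr e1, lintegral_congr e2, lintegral_const_mul' _ _ ENNReal.ofReal_ne_top,
      lintegral_const_mul' _ _ ENNReal.ofReal_ne_top, h1]
  · refine ENNReal.measurable_ofReal.comp ?_
    exact (measurable_snd.const_mul 2).mul ((hU.comp measurable_fst).const_div 1)

lemma inner1 {a u : ℝ} (ha : 0 ≤ a) (hu : 0 ≤ u) :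
    ∫⁻ c in Ioc 1 a, ENNReal.ofReal (2 * c * (1 / u)) = ENNReal.ofReal ((a ^ 2 - 1) / u) := by
  by_cases h : 1 ≤ a
  · rw [← ofReal_integral_eq_lintegral_ofReal, ← intervalIntegral.integral_of_le h,
      intervalIntegral.integral_mul_const, intervalIntegral.integral_const_mul, integral_id]
    · congr 1; ring
    · rw [← IntegrableOn, ← intervalIntegrable_iff_integrableOn_Ioc_of_le h]
      exact Continuous.intervalIntegrable (by fun_prop) _ _
    · filter_upwards [ae_restrict_mem measurableSet_Ioc] with c hc
      have : 0 < c := by linarith [hc.1]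
      simp only [Pi.zero_apply]; positivity
  · push Not at h
    rw [Ioc_eq_empty (by linarith), ENNReal.ofReal_of_nonpos]
    · simp
    · exact div_nonpos_of_nonpos_of_nonneg (by nlinarith) hu

lemma inner2 {a : ℝ} : ∫⁻ _ in Ioc 1 a, (2 : ENNReal) = 2 * ENNReal.ofReal (a - 1) := by
  simp

lemma lv_bound [IsProbabilityMeasure P] (hM : Measurable M) (hU : Measurable U) (h : Lv P M U)
    (h0 : ∀ᵐ ω ∂P, 0 ≤ U ω) (hM0 : ∀ᵐ ω ∂P, 0 ≤ M ω) (h1 : ∀ᵐ ω ∂P, M ω - 1 ≤ U ω) :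
    ∫⁻ ω, ENNReal.ofReal (M ω - 1) ∂P ≤ 2 := by
  have hK : ∀ K : ℕ, ∫⁻ ω, ENNReal.ofReal (min (M ω) K - 1) ∂P ≤ 2 := by
    intro K
    have ht := lv_tonelli hM hU h (S := Ioc 1 (K:ℝ)) measurableSet_Ioc (fun x hx => hx.1)
    have e : ∀ ω, Ioc 1 (K:ℝ) ∩ Iic (M ω) = Ioc 1 (min (M ω) K) := by
      intro ω; rw [Ioc_inter_Iic, inf_comm]
    simp only [e, inner2] at ht
    rw [lintegral_const_mul' _ _ (by norm_num)] at ht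
    set X := ∫⁻ ω, ENNReal.ofReal (min (M ω) K - 1) ∂P with hX
    have hXfin : X ≠ ⊤ := by
      have : X ≤ ∫⁻ _, ENNReal.ofReal K ∂P :=
        lintegral_mono (fun ω => ENNReal.ofReal_le_ofReal (by
          have := min_le_right (M ω) (K:ℝ); linarith))
      refine ne_top_of_le_ne_top ?_ this
      simp
    have hle : 2 * X ≤ X + 2 := by
      rw [← ht]
      have : X + 2 = ∫⁻ ω, (ENNReal.ofReal (min (M ω) K - 1) + 2) ∂P := by
        rw [lintegral_add_right _ measurable_const]; simp [hX]
      rw [this]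
      refine lintegral_mono_ae ?_
      filter_upwards [h0, hM0, h1] with ω a b d
      set m := min (M ω) K with hm
      have hm0 : 0 ≤ m := le_min b (Nat.cast_nonneg K)
      have hmM : m ≤ M ω := min_le_left _ _
      rw [inner1 hm0 a]
      by_cases hm1 : m ≤ 1
      · rw [ENNReal.ofReal_of_nonpos (div_nonpos_of_nonpos_of_nonneg (by nlinarith) a)]
        exact bot_le
      · push Not at hm1
        have : (m ^ 2 - 1) / U ω ≤ (m - 1) + 2 := by
          rw [div_le_iff₀ (by linarith)]
          nlinarith
        refine (ENNReal.ofReal_le_ofReal this).trans ?_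
        rw [ENNReal.ofReal_add (by linarith) (by norm_num)]
        simp
    rw [two_mul] at hle
    exact (ENNReal.add_le_add_iff_left hXfin).1 hle
  have hlim := lintegral_tendsto_of_tendsto_of_monotone (μ := P)
    (f := fun (K : ℕ) ω => ENNReal.ofReal (min (M ω) K - 1)) (F := fun ω => ENNReal.ofReal (M ω - 1))
    (fun K => by
      refine (ENNReal.measurable_ofReal.comp ?_).aemeasurable
      exact (hM.min measurable_const).sub_const 1)
    (ae_of_all _ (fun ω K L hKL => ENNReal.ofReal_le_ofReal (by
      have : (K:ℝ) ≤ L := by exact_mod_cast hKL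
      have := min_le_min_left (M ω) this
      linarith)))
    (ae_of_all _ (fun ω => by
      obtain ⟨K, hK⟩ := exists_nat_ge (M ω)
      refine tendsto_atTop_of_eventually_const (i₀ := K) (fun L hL => ?_)
      have : (K:ℝ) ≤ L := by exact_mod_cast hL
      rw [min_eq_left (by linarith)]))
  exact le_of_tendsto' hlim hK

lemma lv_exact [IsProbabilityMeasure P] (hM : Measurable M) (hU : Measurable U) (h : Lv P M U)
    (h0 : ∀ᵐ ω ∂P, 0 < U ω) (h1 : ∀ᵐ ω ∂P, M ω - 1 = U ω) : ∫ ω, U ω ∂P = 2 := by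
  have hfin := lv_bound hM hU h (h0.mono fun _ h => h.le)
    (by filter_upwards [h0, h1] with ω a b; linarith) (h1.mono fun _ h => h.le)
  have ht := lv_tonelli hM hU h (S := Ioi 1) measurableSet_Ioi subset_rfl
  simp only [Ioi_inter_Iic, inner2] at ht
  rw [lintegral_const_mul' _ _ (by norm_num)] at ht
  have e : ∫⁻ ω, (∫⁻ c in Ioc 1 (M ω), ENNReal.ofReal (2 * c * (1 / U ω))) ∂P =
      ∫⁻ ω, (ENNReal.ofReal (M ω - 1) + 2) ∂P := by
    refine lintegral_congr_ae ?_
    filter_upwards [h0, h1] with ω a b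
    rw [inner1 (by linarith) a.le]
    have : ((M ω) ^ 2 - 1) / U ω = (M ω - 1) + 2 := by
      rw [← b] at a ⊢
      field_simp
      ring
    rw [this, ENNReal.ofReal_add (by linarith) (by norm_num)]
    simp
  rw [e, lintegral_add_right _ measurable_const] at ht
  set X := ∫⁻ ω, ENNReal.ofReal (M ω - 1) ∂P with hX
  have hXfin : X ≠ ⊤ := ne_top_of_le_ne_top (by norm_num) hfin
  have hX2 : X = 2 := by
    rw [two_mul] at ht
    have := (ENNReal.add_right_inj hXfin).1 ht
    rw [← this]; simp
  rw [integral_eq_lintegral_of_nonneg_ae (h0.mono fun _ h => h.le) hU.aestronglyMeasurable]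
  have : ∫⁻ ω, ENNReal.ofReal (U ω) ∂P = X :=
    lintegral_congr_ae (h1.mono fun ω hω => by simp only [hω])
  rw [this, hX2]; simp

end absl


section fin
variable {Ω : Type*} [MeasurableSpace Ω] {P : Measure Ω}
  {γ : ℝ → Ω → EuclideanSpace ℝ (Fin 4)}

lemma hR_one_ge {x K : ℝ} (hx : 0 ≤ x) (hxK : x ≤ K) : rexp (-K) ≤ hR 1 x := by
  have := intervalIntegral.integral_mono_on (f := fun _ => rexp (-K)) (g := fun l => rexp (-l * x))
    (a := 0) (b := 1) (μ := volume) zero_le_one (Continuous.intervalIntegrable (by fun_prop) _ _)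
    (Continuous.intervalIntegrable (by fun_prop) _ _) (fun l hl => by
      apply exp_le_exp.2
      have h1 : l * x ≤ 1 * x := mul_le_mul_of_nonneg_right hl.2 hx
      linarith)
  simpa [hR] using this

lemma small_prob [IsProbabilityMeasure P] (hγ : IsStdBMVec 4 P γ) {T : ℝ} (hT : 0 < T) (K : ℝ) :
    P.real {ω | sqBessel4 γ T ω ≤ K} ≤ rexp K / (1 + 2 * T) := by
  have h1 := onestep hγ (t := 0) (d := T) (R := 1) le_rfl hT zero_le_one (E := univ) MeasurableSet.univ
  simp only [Measure.restrict_univ, zero_add, sq_zero hγ, hR_zero, integral_const, probReal_univ,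
    one_smul, mul_one] at h1
  set B := {ω | sqBessel4 γ T ω ≤ K} with hB
  have hBm : MeasurableSet B := sq_meas hγ T measurableSet_Iic
  have h2 : ∫ ω, B.indicator (fun _ => rexp (-K)) ω ∂P ≤ ∫ ω, hR 1 (sqBessel4 γ T ω) ∂P := by
    refine integral_mono ((integrable_const _).indicator hBm) (hR_sq_integrable hγ zero_le_one T)
      (fun ω => ?_)
    by_cases h : ω ∈ B
    · simp only [indicator_of_mem h]; exact hR_one_ge (sq_nn T ω) h
    · simp only [indicator_of_notMem h]; exact hR_nonneg zero_le_one
  rw [integral_indicator_const _ hBm, h1, smul_eq_mul, exp_neg] at h2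
  have := exp_pos K
  rw [div_eq_mul_one_div, mul_comm (rexp K)]
  calc P.real B = P.real B * (rexp K)⁻¹ * rexp K := by field_simp
    _ ≤ _ := by gcongr

lemma max_prob [IsProbabilityMeasure P] (hγ : IsStdBMVec 4 P γ) {T : ℕ} (hT : 0 < T) {K : ℝ}
    (hK : 1 < K) : P.real {ω | K ≤ Ms γ T ω} ≤ 2 / (K - 1) := by
  have h := lv_bound (Ms_meas hγ hT) (Us_meas hγ hT) (level_Lv hγ hT) (ae_of_all _ (Us_nn T))
    (ae_of_all _ (fun ω => (Us_nn T ω).trans (Us_le_Ms hγ hT ω))) (ae_of_all _ (Ms_sub_le hγ hT))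
  have hm := mul_meas_ge_le_lintegral (μ := P) (f := fun ω => ENNReal.ofReal (Ms γ T ω - 1))
    (ENNReal.measurable_ofReal.comp ((Ms_meas hγ hT).sub_const 1)) (ENNReal.ofReal (K - 1))
  have hsub : {ω | K ≤ Ms γ T ω} ⊆ {ω | ENNReal.ofReal (K - 1) ≤ ENNReal.ofReal (Ms γ T ω - 1)} :=
    fun ω hω => ENNReal.ofReal_le_ofReal (sub_le_sub_right hω 1)
  have h3 : ENNReal.ofReal (K - 1) * P {ω | K ≤ Ms γ T ω} ≤ 2 :=
    (mul_le_mul_right (measure_mono hsub) _).trans (hm.trans h)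
  have h4 := ENNReal.toReal_mono (by norm_num) h3
  rw [ENNReal.toReal_mul, ENNReal.toReal_ofReal (by linarith)] at h4
  rw [le_div_iff₀ (by linarith), mul_comm]
  simpa [measureReal_def] using h4

lemma dd_finite [IsProbabilityMeasure P] (hγ : IsStdBMVec 4 P γ) :
    ∀ᵐ ω ∂P, ∃ t : ℝ, 0 ≤ t ∧ 1 ≤ DD (fun s => sqBessel4 γ s ω) t := by
  set N := {ω | ¬ ∃ t : ℝ, 0 ≤ t ∧ 1 ≤ DD (fun s => sqBessel4 γ s ω) t} with hN
  have hb : ∀ T : ℕ, 0 < T → ∀ K : ℝ, 1 < K → P.real N ≤ 2 / (K - 1) + rexp K / (1 + 2 * T) := by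
    intro T hT K hK
    have hT' : (0:ℝ) < T := by exact_mod_cast hT
    have hsub : N ⊆ {ω | K ≤ Ms γ T ω} ∪ {ω | sqBessel4 γ T ω ≤ K} := by
      intro ω hω
      have hs : Sg γ T ω = T := by
        rcases sig_mem (T := T) (sq_cont hγ ω) hT'.le with h | h
        · exact absurd ⟨_, h⟩ hω
        · exact h
      by_cases h : sqBessel4 γ T ω ≤ K
      · exact Or.inr h
      · left
        have := Us_le_Ms hγ hT ω
        unfold Us at this
        rw [hs] at this
        exact (not_le.1 h).le.trans this
    calc P.real N ≤ _ := measureReal_mono hsub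
      _ ≤ _ := measureReal_union_le _ _
      _ ≤ _ := add_le_add (max_prob hγ hT hK) (small_prob hγ hT' K)
  have hz : P.real N ≤ 0 := by
    by_contra! hp
    set p := P.real N
    have h1 := hb
    set K : ℝ := 4 / p + 2 with hKdef
    have hK : 1 < K := by have : 0 < 4 / p := by positivity
                          linarith
    obtain ⟨T, hT⟩ := exists_nat_gt (rexp K / p)
    have hT0 : (0:ℝ) < T := lt_trans (by positivity) hT
    have h2 := hb T (by exact_mod_cast hT0) K hK
    have h3 : 2 / (K - 1) < p / 2 := by
      rw [div_lt_iff₀ (by linarith)]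
      have : p / 2 * (K - 1) = 2 + p / 2 := by rw [hKdef]; field_simp; ring
      rw [this]; linarith
    have h4 : rexp K / (1 + 2 * T) < p / 2 := by
      rw [div_lt_iff₀ (by positivity)]
      rw [div_lt_iff₀ hp] at hT
      nlinarith
    linarith
  have hz' : P N = 0 := by
    have : P.real N = 0 := le_antisymm hz measureReal_nonneg
    simpa [measureReal_eq_zero_iff] using this
  filter_upwards [measure_eq_zero_iff_ae_notMem.1 hz'] with ω hω
  by_contra h
  exact hω h

theorem main_thm [IsProbabilityMeasure P] (hγ : IsStdBMVec 4 P γ) :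
    ∫ ω, sqBessel4 γ (ddTime 1 (sqBessel4 γ) ω) ω ∂P = 2 := by
  set Ut : Ω → ℝ := fun ω => sqBessel4 γ (ddTime 1 (sqBessel4 γ) ω) ω with hUt
  set Mt : Ω → ℝ := fun ω => RM (fun s => sqBessel4 γ s ω) (ddTime 1 (sqBessel4 γ) ω) with hMt
  have hev : ∀ᵐ ω ∂P, ∃ n₀ : ℕ, ∀ n ≥ n₀, Us γ (n+1) ω = Ut ω ∧ Ms γ (n+1) ω = Mt ω ∧ Mt ω - 1 = Ut ω := by
    filter_upwards [dd_finite hγ] with ω ⟨t, ht, hd⟩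
    obtain ⟨n₀, hn₀⟩ := exists_nat_ge t
    refine ⟨n₀, fun n hn => ?_⟩
    have hn' : (n₀:ℝ) ≤ n := by exact_mod_cast hn
    have hlt : t < ((n+1 : ℕ) : ℝ) := by push_cast; linarith
    have hs : Sg γ (n+1) ω = ddTime 1 (sqBessel4 γ) ω := by
      rw [ddTime_eq]; exact sig_eq_dd ht hd hlt.le
    have hle : Sg γ (n+1) ω ≤ t := by
      rw [hs, ddTime_eq, ← sig_eq_dd ht hd le_rfl]
      exact sig_le ht
    have h1 := DD_sig_of_lt (sq_cont hγ ω) (T := ((n+1 : ℕ) : ℝ)) (by positivity) (hle.trans_lt hlt)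
    refine ⟨by rw [Us, hs], by rw [Ms, hs], ?_⟩
    change DD _ (Sg γ (n+1) ω) = 1 at h1
    rw [hs] at h1
    unfold DD at h1
    simp only [hUt, hMt]
    linarith
  have hUn : ∀ n : ℕ, Measurable (Us γ (n+1)) := fun n => Us_meas hγ (Nat.succ_pos n)
  have hMn : ∀ n : ℕ, Measurable (Ms γ (n+1)) := fun n => Ms_meas hγ (Nat.succ_pos n)
  have hUa : AEMeasurable Ut P := by
    refine aemeasurable_of_tendsto_metrizable_ae atTop (f := fun n : ℕ => Us γ (n+1))
      (fun n => (hUn n).aemeasurable) ?_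
    filter_upwards [hev] with ω ⟨n₀, h⟩
    exact tendsto_atTop_of_eventually_const (i₀ := n₀) (fun n hn => (h n hn).1)
  have hMa : AEMeasurable Mt P := by
    refine aemeasurable_of_tendsto_metrizable_ae atTop (f := fun n : ℕ => Ms γ (n+1))
      (fun n => (hMn n).aemeasurable) ?_
    filter_upwards [hev] with ω ⟨n₀, h⟩
    exact tendsto_atTop_of_eventually_const (i₀ := n₀) (fun n hn => (h n hn).2.1)
  have hpos : ∀ᵐ ω ∂P, 0 < Ut ω := by
    have hnz : ∀ᵐ ω ∂P, ∀ n : ℕ, ¬ (Us γ (n+1) ω = 0 ∧ 1 / 2 ≤ Ms γ (n+1) ω) :=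
      ae_all_iff.2 (fun n => not_zero hγ (Nat.succ_pos n))
    filter_upwards [hev, hnz] with ω ⟨n₀, h⟩ hz
    obtain ⟨a, b, d⟩ := h n₀ le_rfl
    have h0 : 0 ≤ Ut ω := sq_nn _ _
    refine lt_of_le_of_ne h0 (fun he => hz n₀ ⟨by rw [a, ← he], ?_⟩)
    rw [b]; linarith
  have hLv : Lv P Mt Ut := by
    intro c hc
    have hc0 : 0 < c - 1 := by linarith
    have hmeas : ∀ (f : Ω → ENNReal), Measurable f → ∀ n : ℕ,
        Measurable (fun ω => (Ici c).indicator (fun _ => f ω) (Ms γ (n+1) ω)) := by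
      intro f hf n
      have : (fun ω => (Ici c).indicator (fun _ => f ω) (Ms γ (n+1) ω)) =
        (Ms γ (n+1) ⁻¹' Ici c).indicator f := by funext ω; rfl
      rw [this]
      exact hf.indicator (hMn n measurableSet_Ici)
    have l1 : Tendsto (fun n : ℕ => ∫⁻ ω, (Ici c).indicator
        (fun _ => ENNReal.ofReal (1 / Us γ (n+1) ω)) (Ms γ (n+1) ω) ∂P) atTop
        (𝓝 (∫⁻ ω, (Ici c).indicator (fun _ => ENNReal.ofReal (1 / Ut ω)) (Mt ω) ∂P)) := by
      refine tendsto_lintegral_of_dominated_convergence (fun _ => ENNReal.ofReal (1 / (c - 1)))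
        (fun n => hmeas _ (ENNReal.measurable_ofReal.comp ((hUn n).const_div 1)) n) ?_ ?_ ?_
      · intro n
        refine ae_of_all _ (fun ω => ?_)
        by_cases h : Ms γ (n+1) ω ∈ Ici c
        · simp only [indicator_of_mem h]
          have h' : c ≤ Ms γ (n+1) ω := h
          have := Ms_sub_le hγ (Nat.succ_pos n) ω
          exact ENNReal.ofReal_le_ofReal (one_div_le_one_div_of_le hc0 (by linarith))
        · simp only [indicator_of_notMem h]; exact bot_le
      · simp
      · filter_upwards [hev] with ω ⟨n₀, h⟩
        exact tendsto_atTop_of_eventually_const (i₀ := n₀)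
          (fun n hn => by rw [(h n hn).1, (h n hn).2.1])
    have l2 : Tendsto (fun n : ℕ => ∫⁻ ω, (Ici c).indicator
        (fun _ => ENNReal.ofReal (1 / c)) (Ms γ (n+1) ω) ∂P) atTop
        (𝓝 (∫⁻ ω, (Ici c).indicator (fun _ => ENNReal.ofReal (1 / c)) (Mt ω) ∂P)) := by
      refine tendsto_lintegral_of_dominated_convergence (fun _ => ENNReal.ofReal (1 / c))
        (fun n => hmeas _ measurable_const n) ?_ ?_ ?_
      · intro n
        exact ae_of_all _ (fun ω => indicator_le_self _ _ _)
      · simp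
      · filter_upwards [hev] with ω ⟨n₀, h⟩
        exact tendsto_atTop_of_eventually_const (i₀ := n₀)
          (fun n hn => by rw [(h n hn).2.1])
    refine tendsto_nhds_unique l1 (l2.congr (fun n => ?_))
    exact (level_Lv hγ (Nat.succ_pos n) c hc).symm
  have hLv' : Lv P (hMa.mk Mt) (hUa.mk Ut) := by
    intro c hc
    rw [lintegral_congr_ae (show _ =ᵐ[P]
      (fun ω => (Ici c).indicator (fun _ => ENNReal.ofReal (1 / Ut ω)) (Mt ω)) by
        filter_upwards [hMa.ae_eq_mk, hUa.ae_eq_mk] with ω a b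
        rw [a, b]),
      lintegral_congr_ae (show (fun ω => (Ici c).indicator (fun _ => ENNReal.ofReal (1 / c)) (hMa.mk Mt ω)) =ᵐ[P]
      (fun ω => (Ici c).indicator (fun _ => ENNReal.ofReal (1 / c)) (Mt ω)) by
        filter_upwards [hMa.ae_eq_mk] with ω a
        rw [a])]
    exact hLv c hc
  have hfin := lv_exact hMa.measurable_mk hUa.measurable_mk hLv'
    (by filter_upwards [hpos, hUa.ae_eq_mk] with ω a b; rwa [← b])
    (by
      filter_upwards [hev, hMa.ae_eq_mk, hUa.ae_eq_mk] with ω ⟨n₀, h⟩ a b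
      rw [← a, ← b]; exact (h n₀ le_rfl).2.2)
  rw [← hfin]
  exact integral_congr_ae hUa.ae_eq_mk

end fin

/-- for a squared four-dimensional Bessel process `U` started at `0` and
`τ₁ := inf {t ≥ 0 : Ū(t) - U(t) ≥ 1}`, one has `E[U(τ₁)] = 2`. -/
theorem sqBessel4_at_drawdown_time_expectation
    {Ω : Type*} [MeasurableSpace Ω] (P : Measure Ω) [IsProbabilityMeasure P]
    (γ : ℝ → Ω → EuclideanSpace ℝ (Fin 4)) (hγ : IsStdBMVec 4 P γ) :
    ∫ ω, sqBessel4 γ (ddTime 1 (sqBessel4 γ) ω) ω ∂P = 2 := by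
  exact main_thm hγ
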